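/- There exist positive constants c, C and Q₀ (depending only on f₁ and f₂) such that for every integer q ≥ Q₀ and every δ ∈ (0,1/2) with δ ≥ C q^{-1/5}(log q)^{2/5}, one has A(q,δ) ≥ c δ² q. -/

import Mathlib

open Set Real

/-- Distance from a real number to the nearest integer. -/
noncomputable def nint (y : ℝ) : ℝ := |y - round y|

/-- The additive character `y ↦ exp (2 * π * I * y)`. -/
noncomputable def unitExp (y : ℝ) : ℂ := Complex.exp ((2 * π * y : ℝ) * Complex.I)

lemma norm_unitExp (y : ℝ) : ‖unitExp y‖ = 1 := Complex.norm_exp_ofReal_mul_I _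

lemma unitExp_add (x y : ℝ) : unitExp (x + y) = unitExp x * unitExp y := by
  unfold unitExp
  rw [← Complex.exp_add]
  congr 1
  push_cast
  ring

lemma unitExp_zero : unitExp 0 = 1 := by simp [unitExp]

lemma unitExp_neg (x : ℝ) : unitExp (-x) = (starRingEnd ℂ) (unitExp x) := by
  unfold unitExp
  rw [← Complex.exp_conj]
  congr 1
  rw [map_mul, Complex.conj_ofReal, Complex.conj_I]
  push_cast
  ring

lemma unitExp_int (m : ℤ) : unitExp m = 1 := by
  unfold unitExp
  rw [Complex.exp_eq_one_iff]
  exact ⟨m, by push_cast; ring⟩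

lemma unitExp_eq (y : ℝ) :
    unitExp y = ⟨Real.cos (2 * π * y), Real.sin (2 * π * y)⟩ := by
  apply Complex.ext
  · exact Complex.exp_ofReal_mul_I_re _
  · exact Complex.exp_ofReal_mul_I_im _

/-- A finite set of natural numbers without gaps. -/
def GapFree (s : Finset ℕ) : Prop := ∀ x ∈ s, ∀ y ∈ s, ∀ z, x ≤ z → z ≤ y → z ∈ s

lemma norm_sum_unitExp_le_card (g : ℕ → ℝ) (s : Finset ℕ) :
    ‖∑ n ∈ s, unitExp (g n)‖ ≤ s.card := by
  refine (norm_sum_le _ _).trans ?_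
  simp [norm_unitExp]

lemma two_mul_le_sin_pi_mul {t θ : ℝ} (hθ : 0 < θ) (h1 : θ ≤ t) (h2 : t ≤ 1 - θ) :
    2 * θ ≤ Real.sin (π * t) := by
  have hp := Real.pi_pos
  rcases le_total t (1 / 2) with h | h
  · have := Real.mul_le_sin (x := π * t) (by nlinarith) (by nlinarith)
    have e : 2 / π * (π * t) = 2 * t := by field_simp
    rw [e] at this
    linarith
  · have := Real.mul_le_sin (x := π * (1 - t)) (by nlinarith) (by nlinarith)
    have e : 2 / π * (π * (1 - t)) = 2 * (1 - t) := by field_simp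
    rw [e, show π * (1 - t) = π - π * t by ring, Real.sin_pi_sub] at this
    linarith

/-- The partial-summation weight `1 / (1 - exp (2 * π * I * t))`. -/
noncomputable def klWeight (t : ℝ) : ℂ := ⟨1 / 2, Real.cos (π * t) / Real.sin (π * t) / 2⟩

lemma klWeight_mul {t : ℝ} (h : Real.sin (π * t) ≠ 0) : (1 - unitExp t) * klWeight t = 1 := by
  rw [unitExp_eq, klWeight, show 2 * π * t = 2 * (π * t) by ring, Real.cos_two_mul,
    Real.sin_two_mul]
  have h2 := Real.sin_sq_add_cos_sq (π * t)
  apply Complex.ext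
  · simp
    field_simp
    nlinarith
  · simp
    field_simp
    linear_combination -2 * Real.cos (π * t) * h2

lemma norm_klWeight_le {t θ : ℝ} (hθ : 0 < θ) (h1 : θ ≤ t) (h2 : t ≤ 1 - θ) :
    ‖klWeight t‖ ≤ 1 / (4 * θ) := by
  have hs := two_mul_le_sin_pi_mul hθ h1 h2
  have h2 := Real.sin_sq_add_cos_sq (π * t)
  have hpos : 0 < Real.sin (π * t) := by linarith
  have : ‖klWeight t‖ = 1 / (2 * Real.sin (π * t)) := by
    rw [Complex.norm_eq_sqrt_sq_add_sq, Real.sqrt_eq_iff_mul_self_eq (by positivity) (by positivity)]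
    simp only [klWeight]
    field_simp
    linarith
  rw [this]
  apply one_div_le_one_div_of_le <;> linarith

lemma cot_bound {t θ : ℝ} (hθ : 0 < θ) (h1 : θ ≤ t) (h2 : t ≤ 1 - θ) :
    |Real.cos (π * t) / Real.sin (π * t)| ≤ 1 / (2 * θ) := by
  have hs := two_mul_le_sin_pi_mul hθ h1 h2
  rw [abs_div, abs_of_pos (a := Real.sin (π * t)) (by linarith)]
  exact div_le_div₀ zero_le_one (Real.abs_cos_le_one _) (by linarith) hs

lemma norm_klWeight_sub_le {s t : ℝ} (hs : 0 < s) (hst : s ≤ t) (ht : t < 1) :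
    ‖klWeight t - klWeight s‖ =
      (Real.cos (π * s) / Real.sin (π * s) - Real.cos (π * t) / Real.sin (π * t)) / 2 := by
  have hp := Real.pi_pos
  have h1 : 0 < Real.sin (π * s) := Real.sin_pos_of_pos_of_lt_pi (by positivity) (by nlinarith)
  have h2 : 0 < Real.sin (π * t) := Real.sin_pos_of_pos_of_lt_pi (by nlinarith) (by nlinarith)
  have h3 : 0 ≤ Real.sin (π * t - π * s) :=
    Real.sin_nonneg_of_nonneg_of_le_pi (by nlinarith) (by nlinarith)
  rw [Real.sin_sub] at h3
  have h4 : 0 ≤ Real.cos (π * s) / Real.sin (π * s) - Real.cos (π * t) / Real.sin (π * t) := by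
    rw [div_sub_div _ _ h1.ne' h2.ne']
    apply div_nonneg _ (by positivity)
    linarith
  rw [Complex.norm_eq_sqrt_sq_add_sq, Real.sqrt_eq_iff_mul_self_eq (by positivity) (by linarith)]
  simp only [klWeight, Complex.sub_re, Complex.sub_im]
  ring

lemma GapFree.eq_Ico {s : Finset ℕ} (hs : GapFree s) (hne : s.Nonempty) :
    ∃ a k, s = Finset.Ico a (a + k + 1) := by
  refine ⟨s.min' hne, s.max' hne - s.min' hne, ?_⟩
  have hle := s.min'_le _ (s.max'_mem hne)
  ext x
  rw [Finset.mem_Ico]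
  constructor
  · intro hx
    have := s.min'_le x hx
    have := s.le_max' x hx
    omega
  · rintro ⟨h1, h2⟩
    exact hs _ (s.min'_mem hne) _ (s.max'_mem hne) _ h1 (by omega)

/-- **Kusmin-Landau inequality.** -/
lemma kusmin_landau (g : ℕ → ℝ) (s : Finset ℕ) (hs : GapFree s) (m : ℤ) {θ : ℝ} (hθ : 0 < θ)
    (hmono : ∀ n ∈ s, ∀ n' ∈ s, n ≤ n' → g (n + 1) - g n ≤ g (n' + 1) - g n')
    (h1 : ∀ n ∈ s, m + θ ≤ g (n + 1) - g n) (h2 : ∀ n ∈ s, g (n + 1) - g n ≤ m + 1 - θ) :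
    ‖∑ n ∈ s, unitExp (g n)‖ ≤ 1 / θ := by
  rcases s.eq_empty_or_nonempty with rfl | hne
  · simp; exact hθ.le
  obtain ⟨a, k, rfl⟩ := hs.eq_Ico hne
  set d : ℕ → ℝ := fun n => g (n + 1) - g n - m with hd
  have hstep : ∀ n ∈ Finset.Ico a (a + k + 1),
      unitExp (g n) = (unitExp (g n) - unitExp (g (n + 1))) * klWeight (d n) := by
    intro n hn
    have e1 : unitExp (g (n + 1)) = unitExp (g n) * unitExp (d n) := by
      rw [show g (n + 1) = g n + d n + m by simp only [hd]; ring, unitExp_add _ (m : ℝ),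
        unitExp_int, mul_one, unitExp_add]
    have hsin : Real.sin (π * d n) ≠ 0 := by
      have := two_mul_le_sin_pi_mul (t := d n) hθ (by simp only [hd]; linarith [h1 n hn])
        (by simp only [hd]; linarith [h2 n hn])
      linarith
    rw [e1]
    linear_combination -unitExp (g n) * klWeight_mul hsin
  have hd1 : ∀ n ∈ Finset.Ico a (a + k + 1), θ ≤ d n := fun n hn => by
    simp only [hd]; linarith [h1 n hn]
  have hd2 : ∀ n ∈ Finset.Ico a (a + k + 1), d n ≤ 1 - θ := fun n hn => by
    simp only [hd]; linarith [h2 n hn]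
  have key : ∀ j ≤ k, ‖∑ n ∈ Finset.Ico a (a + j + 1), unitExp (g n)
        + unitExp (g (a + j + 1)) * klWeight (d (a + j))‖
      ≤ ‖klWeight (d a)‖ + (Real.cos (π * d a) / Real.sin (π * d a)
        - Real.cos (π * d (a + j)) / Real.sin (π * d (a + j))) / 2 := by
    intro j
    induction j with
    | zero =>
      intro _
      have h := hstep a (by simp)
      have e : unitExp (g a) + unitExp (g (a + 1)) * klWeight (d a)
          = unitExp (g a) * klWeight (d a) := by linear_combination h
      simp [e, norm_unitExp]
    | succ j ih =>
      intro hj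
      have ih := ih (by omega)
      have h := hstep (a + (j + 1)) (by simp; omega)
      have m1 : a + j ∈ Finset.Ico a (a + k + 1) := by simp; omega
      have m2 : a + (j + 1) ∈ Finset.Ico a (a + k + 1) := by simp; omega
      have hw := norm_klWeight_sub_le (s := d (a + j)) (t := d (a + (j + 1)))
        (by linarith [hd1 _ m1]) (by
          simp only [hd]; linarith [hmono _ m1 _ m2 (by omega)]) (by linarith [hd2 _ m2])
      rw [Finset.sum_Ico_succ_top (by omega)]
      have e : ∑ n ∈ Finset.Ico a (a + (j + 1)), unitExp (g n) + unitExp (g (a + (j + 1)))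
          + unitExp (g (a + (j + 1) + 1)) * klWeight (d (a + (j + 1)))
          = (∑ n ∈ Finset.Ico a (a + j + 1), unitExp (g n)
            + unitExp (g (a + j + 1)) * klWeight (d (a + j)))
            + unitExp (g (a + (j + 1))) * (klWeight (d (a + (j + 1))) - klWeight (d (a + j))) := by
        rw [show a + j + 1 = a + (j + 1) by ring]
        linear_combination h
      rw [e]
      refine (norm_add_le _ _).trans ?_
      rw [norm_mul, norm_unitExp, hw]
      linarith
  have hk := key k le_rfl
  have ma : a ∈ Finset.Ico a (a + k + 1) := by simp
  have mk : a + k ∈ Finset.Ico a (a + k + 1) := by simp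
  have b1 := norm_klWeight_le hθ (hd1 _ ma) (hd2 _ ma)
  have b2 := norm_klWeight_le hθ (hd1 _ mk) (hd2 _ mk)
  have b3 := abs_le.1 (cot_bound hθ (hd1 _ ma) (hd2 _ ma))
  have b4 := abs_le.1 (cot_bound hθ (hd1 _ mk) (hd2 _ mk))
  have e : ∑ n ∈ Finset.Ico a (a + k + 1), unitExp (g n)
      = (∑ n ∈ Finset.Ico a (a + k + 1), unitExp (g n)
        + unitExp (g (a + k + 1)) * klWeight (d (a + k)))
        - unitExp (g (a + k + 1)) * klWeight (d (a + k)) := by ring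
  rw [e]
  refine (norm_sub_le _ _).trans ?_
  rw [norm_mul, norm_unitExp]
  have e4 : 1 / (4 * θ) = (1 / θ) / 4 := by field_simp
  have e2 : 1 / (2 * θ) = (1 / θ) / 2 := by field_simp
  rw [e4] at b1 b2
  rw [e2] at b3 b4
  linarith [b3.2, b4.1]

lemma card_le_of_separated (d : ℕ → ℝ) (s : Finset ℕ) {lam A B : ℝ} (hlam : 0 < lam) (hAB : A ≤ B)
    (hlow : ∀ n ∈ s, ∀ n' ∈ s, n ≤ n' → lam * ((n' : ℝ) - n) ≤ d n' - d n)
    (hA : ∀ n ∈ s, A ≤ d n) (hB : ∀ n ∈ s, d n ≤ B) :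
    (s.card : ℝ) ≤ (B - A) / lam + 1 := by
  rcases s.eq_empty_or_nonempty with rfl | hne
  · have : 0 ≤ (B - A) / lam := div_nonneg (by linarith) hlam.le
    simp; linarith
  have hle := s.min'_le _ (s.max'_mem hne)
  have hsub : s ⊆ Finset.Icc (s.min' hne) (s.max' hne) := fun x hx =>
    Finset.mem_Icc.2 ⟨s.min'_le x hx, s.le_max' x hx⟩
  have hc := Finset.card_le_card hsub
  rw [Nat.card_Icc] at hc
  have hc' : (s.card : ℝ) ≤ (s.max' hne : ℝ) + 1 - s.min' hne := by
    have : (s.card : ℝ) ≤ ((s.max' hne + 1 - s.min' hne : ℕ) : ℝ) := by exact_mod_cast hc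
    rwa [Nat.cast_sub (by omega), Nat.cast_add, Nat.cast_one] at this
  have h := hlow _ (s.min'_mem hne) _ (s.max'_mem hne) hle
  have h1 := hA _ (s.min'_mem hne)
  have h2 := hB _ (s.max'_mem hne)
  have : (s.max' hne : ℝ) - s.min' hne ≤ (B - A) / lam := by
    rw [le_div_iff₀ hlam]; linarith
  linarith

/-- **Van der Corput's second-derivative test**, in discrete form. -/
lemma van_der_corput (g : ℕ → ℝ) (s : Finset ℕ) (hs : GapFree s) {lam R : ℝ} (hlam : 0 < lam)
    (hlam1 : lam ≤ 1) (hR : 0 ≤ R)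
    (hlow : ∀ n ∈ s, ∀ n' ∈ s, n ≤ n' →
      lam * ((n' : ℝ) - n) ≤ (g (n' + 1) - g n') - (g (n + 1) - g n))
    (hup : ∀ n ∈ s, ∀ n' ∈ s, n ≤ n' → (g (n' + 1) - g n') - (g (n + 1) - g n) ≤ R) :
    ‖∑ n ∈ s, unitExp (g n)‖ ≤ (R + 2) * (5 / √lam) := by
  have hsq : 0 < √lam := Real.sqrt_pos.2 hlam
  rcases s.eq_empty_or_nonempty with rfl | hne
  · simp; positivity
  set d : ℕ → ℝ := fun n => g (n + 1) - g n with hd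
  set θ := √lam with hθ
  have hθ1 : θ ≤ 1 := by rw [hθ]; exact Real.sqrt_le_one.2 hlam1
  have hθl : θ / lam = 1 / θ := by
    rw [div_eq_div_iff hlam.ne' hsq.ne', hθ, Real.mul_self_sqrt hlam.le, one_mul]
  have hθ2 : 1 ≤ 1 / θ := by rw [le_div_iff₀ hsq]; linarith
  have hmono : ∀ n ∈ s, ∀ n' ∈ s, n ≤ n' → d n ≤ d n' := by
    intro n hn n' hn' h
    have := hlow n hn n' hn' h
    have h3 : (0 : ℝ) ≤ (n' : ℝ) - n := by
      have : (n : ℝ) ≤ n' := by exact_mod_cast h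
      linarith
    have := mul_nonneg hlam.le h3
    simp only [hd]; linarith
  have block : ∀ m : ℤ, ‖∑ n ∈ s with ⌊d n⌋ = m, unitExp (g n)‖ ≤ 5 / θ := by
    intro m
    set t := s.filter (fun n => ⌊d n⌋ = m) with ht
    have hts : ∀ n ∈ t, n ∈ s := fun n hn => (Finset.mem_filter.1 hn).1
    have ht1 : ∀ n ∈ t, (m : ℝ) ≤ d n := fun n hn => by
      have := (Finset.mem_filter.1 hn).2
      rw [← this]; exact Int.floor_le _
    have ht2 : ∀ n ∈ t, d n ≤ m + 1 := fun n hn => by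
      have := (Finset.mem_filter.1 hn).2
      rw [← this]; exact (Int.lt_floor_add_one _).le
    have hfl : ∀ x, (m : ℝ) ≤ x → x < m + 1 → ⌊x⌋ = m := fun x h1 h2 => by
      rw [Int.floor_eq_iff]; exact ⟨h1, h2⟩
    have ht3 : ∀ n ∈ t, d n < m + 1 := fun n hn => by
      have := (Finset.mem_filter.1 hn).2
      rw [← this]; exact (Int.lt_floor_add_one _)
    rw [← Finset.sum_filter_add_sum_filter_not t (fun n => d n < m + θ)]
    rw [← Finset.sum_filter_add_sum_filter_not (t.filter (fun n => ¬ d n < m + θ))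
      (fun n => m + 1 - θ < d n)]
    have c1 : ‖∑ n ∈ t with d n < m + θ, unitExp (g n)‖ ≤ 1 / θ + 1 := by
      refine (norm_sum_unitExp_le_card _ _).trans ?_
      have := card_le_of_separated d (t.filter (fun n => d n < m + θ)) (A := m) (B := m + θ)
        hlam (by linarith)
        (fun n hn n' hn' h => hlow n (hts _ (Finset.mem_filter.1 hn).1) n'
          (hts _ (Finset.mem_filter.1 hn').1) h)
        (fun n hn => ht1 _ (Finset.mem_filter.1 hn).1) (fun n hn => (Finset.mem_filter.1 hn).2.le)
      rwa [add_sub_cancel_left, hθl] at this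
    have c2 : ‖∑ n ∈ (t.filter (fun n => ¬ d n < m + θ)) with m + 1 - θ < d n, unitExp (g n)‖
        ≤ 1 / θ + 1 := by
      refine (norm_sum_unitExp_le_card _ _).trans ?_
      have := card_le_of_separated d
        ((t.filter (fun n => ¬ d n < m + θ)).filter (fun n => m + 1 - θ < d n))
        (A := m + 1 - θ) (B := m + 1) hlam (by linarith)
        (fun n hn n' hn' h => hlow n (hts _ (Finset.mem_filter.1 (Finset.mem_filter.1 hn).1).1) n'
          (hts _ (Finset.mem_filter.1 (Finset.mem_filter.1 hn').1).1) h)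
        (fun n hn => (Finset.mem_filter.1 hn).2.le)
        (fun n hn => ht2 _ (Finset.mem_filter.1 (Finset.mem_filter.1 hn).1).1)
      rwa [show (m : ℝ) + 1 - (m + 1 - θ) = θ by ring, hθl] at this
    have c3 : ‖∑ n ∈ (t.filter (fun n => ¬ d n < m + θ)) with ¬ m + 1 - θ < d n, unitExp (g n)‖
        ≤ 1 / θ := by
      have hmem : ∀ n, n ∈ (t.filter (fun n => ¬ d n < m + θ)).filter (fun n => ¬ m + 1 - θ < d n) →
          n ∈ s ∧ m + θ ≤ d n ∧ d n ≤ m + 1 - θ := by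
        intro n hn
        have h1 := Finset.mem_filter.1 hn
        have h2 := Finset.mem_filter.1 h1.1
        exact ⟨hts _ h2.1, not_lt.1 h2.2, not_lt.1 h1.2⟩
      refine kusmin_landau g _ ?_ m hsq ?_ (fun n hn => (hmem n hn).2.1)
        (fun n hn => (hmem n hn).2.2)
      · intro x hx y hy z hxz hzy
        obtain ⟨x1, x2, x3⟩ := hmem x hx
        obtain ⟨y1, y2, y3⟩ := hmem y hy
        have hz := hs x x1 y y1 z hxz hzy
        have l1 := hmono x x1 z hz hxz
        have l2 := hmono z hz y y1 hzy
        simp only [Finset.mem_filter, not_lt, ht]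
        exact ⟨⟨⟨hz, hfl _ (by linarith) (by linarith)⟩, by linarith⟩, by linarith⟩
      · intro n hn n' hn' h
        exact hmono n (hmem n hn).1 n' (hmem n' hn').1 h
    have e5 : 5 / θ = 5 * (1 / θ) := by ring
    rw [e5]
    refine (norm_add_le _ _).trans ?_
    have := (norm_add_le
      (∑ n ∈ (t.filter (fun n => ¬ d n < m + θ)) with m + 1 - θ < d n, unitExp (g n))
      (∑ n ∈ (t.filter (fun n => ¬ d n < m + θ)) with ¬ m + 1 - θ < d n, unitExp (g n)))
    linarith
  set n₀ := s.min' hne with hn₀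
  have hn₀s : n₀ ∈ s := s.min'_mem hne
  have hmaps : ∀ n ∈ s, ⌊d n⌋ ∈ Finset.Icc ⌊d n₀⌋ ⌊d n₀ + R⌋ := by
    intro n hn
    rw [Finset.mem_Icc]
    have hle := s.min'_le n hn
    refine ⟨Int.floor_le_floor (hmono _ hn₀s _ hn hle), Int.floor_le_floor ?_⟩
    have := hup _ hn₀s _ hn hle
    simp only [hd]; linarith
  rw [← Finset.sum_fiberwise_of_maps_to hmaps]
  refine (norm_sum_le _ _).trans ?_
  refine (Finset.sum_le_sum (fun m _ => block m)).trans ?_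
  rw [Finset.sum_const, nsmul_eq_mul, Int.card_Icc]
  have hcard : (((⌊d n₀ + R⌋ + 1 - ⌊d n₀⌋).toNat : ℕ) : ℝ) ≤ R + 2 := by
    have h1 : ⌊d n₀⌋ ≤ ⌊d n₀ + R⌋ := Int.floor_le_floor (by linarith)
    have h2 : (((⌊d n₀ + R⌋ + 1 - ⌊d n₀⌋).toNat : ℕ) : ℤ) = ⌊d n₀ + R⌋ + 1 - ⌊d n₀⌋ :=
      Int.toNat_of_nonneg (by omega)
    have h3 : (((⌊d n₀ + R⌋ + 1 - ⌊d n₀⌋).toNat : ℕ) : ℝ) = (⌊d n₀ + R⌋ : ℝ) + 1 - ⌊d n₀⌋ := by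
      exact_mod_cast congrArg (Int.cast : ℤ → ℝ) h2
    rw [h3]
    have := Int.floor_le (d n₀ + R)
    have := Int.lt_floor_add_one (d n₀)
    linarith
  exact mul_le_mul_of_nonneg_right hcard (by positivity)

lemma mul_sub_le_sub_of_le_hasDerivWithinAt {f f' : ℝ → ℝ} {a b X : ℝ}
    (hf : ∀ x ∈ Icc a b, HasDerivWithinAt f (f' x) (Icc a b) x)
    (hX : ∀ x ∈ Icc a b, X ≤ f' x) :
    ∀ x ∈ Icc a b, ∀ y ∈ Icc a b, x ≤ y → X * (y - x) ≤ f y - f x := by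
  have hd : ∀ x ∈ interior (Icc a b), HasDerivAt f (f' x) x := fun x hx =>
    (hf x (interior_subset hx)).hasDerivAt (mem_interior_iff_mem_nhds.1 hx)
  exact (convex_Icc a b).mul_sub_le_image_sub_of_le_deriv
    (fun x hx => (hf x hx).continuousWithinAt)
    (fun x hx => (hd x hx).differentiableAt.differentiableWithinAt)
    (fun x hx => by rw [(hd x hx).deriv]; exact hX x (interior_subset hx))

lemma abs_sub_le_of_hasDerivWithinAt {f f' : ℝ → ℝ} {a b E : ℝ}
    (hf : ∀ x ∈ Icc a b, HasDerivWithinAt f (f' x) (Icc a b) x)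
    (hE : ∀ x ∈ Icc a b, |f' x| ≤ E) :
    ∀ x ∈ Icc a b, ∀ y ∈ Icc a b, |f y - f x| ≤ E * |y - x| := by
  intro x hx y hy
  have := (convex_Icc a b).norm_image_sub_le_of_norm_hasDerivWithin_le hf hE hx hy
  simpa using this

lemma second_difference_lower {F F' F'' : ℝ → ℝ} {a b X : ℝ}
    (hF : ∀ x ∈ Icc a b, HasDerivWithinAt F (F' x) (Icc a b) x)
    (hF' : ∀ x ∈ Icc a b, HasDerivWithinAt F' (F'' x) (Icc a b) x)
    (hX : ∀ x ∈ Icc a b, X ≤ F'' x) {u v h : ℝ} (hu : a ≤ u) (huv : u ≤ v) (hh : 0 ≤ h)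
    (hv : v + h ≤ b) :
    X * (v - u) * h ≤ (F (v + h) - F v) - (F (u + h) - F u) := by
  have hmap : ∀ w ∈ Icc u v, MapsTo (fun t => w + t) (Icc 0 h) (Icc a b) := by
    intro w hw t ht
    exact ⟨by linarith [hw.1, ht.1], by linarith [hw.2, ht.2]⟩
  have hc : ∀ w ∈ Icc u v, ∀ t ∈ Icc 0 h,
      HasDerivWithinAt (fun t => F (w + t)) (F' (w + t)) (Icc 0 h) t := by
    intro w hw t ht
    have := (hF (w + t) (hmap w hw ht)).comp t ((hasDerivWithinAt_id t (Icc 0 h)).const_add w)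
      (hmap w hw)
    simpa [Function.comp_def] using this
  have hG : ∀ t ∈ Icc 0 h, HasDerivWithinAt (fun t => F (v + t) - F (u + t))
      (F' (v + t) - F' (u + t)) (Icc 0 h) t := fun t ht =>
    (hc v ⟨huv, le_rfl⟩ t ht).sub (hc u ⟨le_rfl, huv⟩ t ht)
  have hlow : ∀ t ∈ Icc 0 h, X * (v - u) ≤ F' (v + t) - F' (u + t) := by
    intro t ht
    have := mul_sub_le_sub_of_le_hasDerivWithinAt hF' hX (u + t) (hmap u ⟨le_rfl, huv⟩ ht) (v + t)
      (hmap v ⟨huv, le_rfl⟩ ht) (by linarith)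
    rwa [show v + t - (u + t) = v - u by ring] at this
  have := mul_sub_le_sub_of_le_hasDerivWithinAt hG hlow 0 ⟨le_rfl, hh⟩ h ⟨hh, le_rfl⟩ hh
  simp only [add_zero, sub_zero] at this
  linarith

lemma van_der_corput_of_deriv {F F' F'' : ℝ → ℝ}
    (hF : ∀ x ∈ Icc (0 : ℝ) 1, HasDerivWithinAt F (F' x) (Icc (0 : ℝ) 1) x)
    (hF' : ∀ x ∈ Icc (0 : ℝ) 1, HasDerivWithinAt F' (F'' x) (Icc (0 : ℝ) 1) x)
    {q : ℕ} (hq : 0 < q) (s : Finset ℕ) (hs : GapFree s) (hsq : ∀ n ∈ s, n < q) {X Y ell : ℝ}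
    (hX : 0 < X) (hXq : X ≤ q) (hY : 0 ≤ Y) (hell : 0 ≤ ell)
    (hlen : ∀ n ∈ s, ∀ n' ∈ s, n ≤ n' → (n' : ℝ) - n ≤ ell * q)
    (hF'' : ∀ n ∈ s, ∀ x ∈ Icc ((n : ℝ) / q) ((n + 1 : ℝ) / q), X ≤ F'' x ∧ F'' x ≤ Y) :
    ‖∑ n ∈ s, unitExp (q * F ((n : ℝ) / q))‖ ≤ (Y * ell + 2) * (5 / √(X / q)) := by
  have hq' : (0 : ℝ) < q := by exact_mod_cast hq
  have main : ∀ n ∈ s, ∀ n' ∈ s, n ≤ n' →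
      X / q * ((n' : ℝ) - n) ≤ (q * F (((n' + 1 : ℕ) : ℝ) / q) - q * F ((n' : ℝ) / q))
        - (q * F (((n + 1 : ℕ) : ℝ) / q) - q * F ((n : ℝ) / q)) ∧
      (q * F (((n' + 1 : ℕ) : ℝ) / q) - q * F ((n' : ℝ) / q))
        - (q * F (((n + 1 : ℕ) : ℝ) / q) - q * F ((n : ℝ) / q)) ≤ Y / q * ((n' : ℝ) - n) := by
    intro n hn n' hn' hle
    have hle' : (n : ℝ) ≤ n' := by exact_mod_cast hle
    have hsub : Icc ((n : ℝ) / q) ((n' + 1 : ℝ) / q) ⊆ Icc 0 1 := by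
      apply Icc_subset_Icc (by positivity)
      rw [div_le_one hq']
      exact_mod_cast hsq n' hn'
    have hb : ∀ x ∈ Icc ((n : ℝ) / q) ((n' + 1 : ℝ) / q), X ≤ F'' x ∧ F'' x ≤ Y := by
      intro x hx
      have hx0 : 0 ≤ x := (hsub hx).1
      have hx1 : (n : ℝ) ≤ x * q := (div_le_iff₀ hq').1 hx.1
      have hx2 : x * q ≤ n' + 1 := (le_div_iff₀ hq').1 hx.2
      rcases eq_or_lt_of_le hx2 with h | h
      · exact hF'' n' hn' x ⟨(div_le_iff₀ hq').2 (by linarith), hx.2⟩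
      · have hfl0 : 0 ≤ x * q := by positivity
        have f1 := Nat.floor_le hfl0
        have f2 := Nat.lt_floor_add_one (x * q)
        refine hF'' ⌊x * q⌋₊ (hs n hn n' hn' _ (Nat.le_floor hx1) ?_) x
          ⟨(div_le_iff₀ hq').2 f1, (le_div_iff₀ hq').2 f2.le⟩
        have : ⌊x * q⌋₊ < n' + 1 := (Nat.floor_lt hfl0).2 (by push_cast; exact h)
        omega
    have d0 : ∀ x ∈ Icc ((n : ℝ) / q) ((n' + 1 : ℝ) / q),
        HasDerivWithinAt F (F' x) (Icc ((n : ℝ) / q) ((n' + 1 : ℝ) / q)) x :=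
      fun x hx => (hF x (hsub hx)).mono hsub
    have d1 : ∀ x ∈ Icc ((n : ℝ) / q) ((n' + 1 : ℝ) / q),
        HasDerivWithinAt F' (F'' x) (Icc ((n : ℝ) / q) ((n' + 1 : ℝ) / q)) x :=
      fun x hx => (hF' x (hsub hx)).mono hsub
    have e0 : ∀ m : ℕ, (((m + 1 : ℕ) : ℝ)) / q = (m : ℝ) / q + 1 / q := fun m => by
      push_cast; ring
    have huv : (n : ℝ) / q ≤ (n' : ℝ) / q := div_le_div_of_nonneg_right hle' hq'.le
    have l1 := second_difference_lower d0 d1 (fun x hx => (hb x hx).1) le_rfl huv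
      (h := 1 / q) (by positivity) (by rw [← add_div])
    have l2 := second_difference_lower (fun x hx => (d0 x hx).neg) (fun x hx => (d1 x hx).neg)
      (X := -Y) (fun x hx => neg_le_neg (hb x hx).2) le_rfl huv
      (h := 1 / q) (by positivity) (by rw [← add_div])
    simp only [Pi.neg_apply] at l2
    rw [e0, e0]
    have e1 : X / q * ((n' : ℝ) - n) = q * (X * ((n' : ℝ) / q - (n : ℝ) / q) * (1 / q)) := by
      field_simp
    have e2 : Y / q * ((n' : ℝ) - n) = q * (Y * ((n' : ℝ) / q - (n : ℝ) / q) * (1 / q)) := by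
      field_simp
    rw [e1, e2]
    constructor
    · have := mul_le_mul_of_nonneg_left l1 hq'.le
      linarith
    · have := mul_le_mul_of_nonneg_left l2 hq'.le
      linarith
  refine van_der_corput (fun n => q * F ((n : ℝ) / q)) s hs (by positivity)
    ((div_le_one hq').2 hXq) (by positivity) (fun n hn n' hn' h => (main n hn n' hn' h).1) ?_
  intro n hn n' hn' h
  refine (main n hn n' hn' h).2.trans ?_
  have := hlen n hn n' hn' h
  calc Y / q * ((n' : ℝ) - n) ≤ Y / q * (ell * q) := by gcongr
    _ = Y * ell := by field_simp

lemma GapFree.filter_of_between {s : Finset ℕ} (hs : GapFree s) {φ : ℕ → ℝ}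
    (hφ : ∀ x ∈ s, ∀ y ∈ s, ∀ z, x ≤ z → z ≤ y → min (φ x) (φ y) ≤ φ z ∧ φ z ≤ max (φ x) (φ y))
    {p : ℝ → Prop} [DecidablePred p] (hp : ∀ u v w, p u → p v → min u v ≤ w → w ≤ max u v → p w) :
    GapFree (s.filter (fun n => p (φ n))) := by
  intro x hx y hy z hxz hzy
  rw [Finset.mem_filter] at hx hy ⊢
  have := hφ x hx.1 y hy.1 z hxz hzy
  exact ⟨hs x hx.1 y hy.1 z hxz hzy, hp _ _ _ hx.2 hy.2 this.1 this.2⟩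

/-- Exponential sum over a range where the second derivative is nonnegative and strictly
monotone, estimated by a dyadic decomposition according to the size of the second derivative. -/
lemma norm_sum_le_of_monotone_second_deriv {F F' F'' : ℝ → ℝ}
    (hF : ∀ x ∈ Icc (0 : ℝ) 1, HasDerivWithinAt F (F' x) (Icc (0 : ℝ) 1) x)
    (hF' : ∀ x ∈ Icc (0 : ℝ) 1, HasDerivWithinAt F' (F'' x) (Icc (0 : ℝ) 1) x)
    {q : ℕ} (hq : 0 < q) {D E : ℝ} (hD : 0 < D) (hE : 0 < E) (hEq : E ≤ q)
    (hlip : ∀ x ∈ Icc (0 : ℝ) 1, ∀ y ∈ Icc (0 : ℝ) 1, |F'' y - F'' x| ≤ E * |y - x|)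
    (k : ℕ) (hk : 2 ^ (k + 1) ≤ q)
    (s : Finset ℕ) (hs : GapFree s) (hsq : ∀ n ∈ s, n < q)
    (hbet : ∀ x ∈ s, ∀ y ∈ s, ∀ z : ℕ, x ≤ z → z ≤ y →
      min (F'' ((x : ℝ) / q)) (F'' ((y : ℝ) / q)) ≤ F'' ((z : ℝ) / q) ∧
      F'' ((z : ℝ) / q) ≤ max (F'' ((x : ℝ) / q)) (F'' ((y : ℝ) / q)))
    (hsep : ∀ x ∈ s, ∀ y ∈ s, x ≤ y →
      D * (((y : ℝ) - x) / q) ≤ |F'' ((y : ℝ) / q) - F'' ((x : ℝ) / q)|)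
    (h0 : ∀ x ∈ s, 0 ≤ F'' ((x : ℝ) / q) ∧ F'' ((x : ℝ) / q) ≤ E) :
    ‖∑ n ∈ s, unitExp (q * F ((n : ℝ) / q))‖ ≤
      k * (15 * (E * √E) / D * √(2 * q) + 10 * √(2 * q) / √(E / 2 ^ k))
        + (q * (E / 2 ^ k) / D + 1) := by
  have hq' : (0 : ℝ) < q := by exact_mod_cast hq
  have hk' : (2 : ℝ) ^ (k + 1) ≤ q := by exact_mod_cast hk
  set φ : ℕ → ℝ := fun n => F'' ((n : ℝ) / q) with hφ
  have hlen : ∀ X : ℝ, ∀ n ∈ s, ∀ n' ∈ s, n ≤ n' → |φ n' - φ n| ≤ X →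
      (n' : ℝ) - n ≤ X / D * q := by
    intro X n hn n' hn' h hX
    have h1 := (hsep n hn n' hn' h).trans hX
    rw [div_mul_eq_mul_div, le_div_iff₀ hD]
    have : D * (((n' : ℝ) - n) / q) * q = ((n' : ℝ) - n) * D := by field_simp
    rw [← this]
    exact mul_le_mul_of_nonneg_right h1 hq'.le
  have level : ∀ X : ℝ, E / 2 ^ k ≤ X → 2 * X ≤ E →
      ‖∑ n ∈ s.filter (fun n => X < φ n ∧ φ n ≤ 2 * X), unitExp (q * F ((n : ℝ) / q))‖ ≤
        15 * (E * √E) / D * √(2 * q) + 10 * √(2 * q) / √(E / 2 ^ k) := by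
    intro X hX1 hX2
    have hX0 : 0 < X := lt_of_lt_of_le (by positivity) hX1
    have hEX : E / q ≤ X / 2 := by
      have : E / q ≤ E / 2 ^ (k + 1) := by gcongr
      rw [pow_succ, ← div_div] at this
      linarith
    have hmem : ∀ n ∈ s.filter (fun n => X < φ n ∧ φ n ≤ 2 * X),
        n ∈ s ∧ X < φ n ∧ φ n ≤ 2 * X := fun n hn => Finset.mem_filter.1 hn
    have hv := van_der_corput_of_deriv hF hF' hq
      (s.filter (fun n => X < φ n ∧ φ n ≤ 2 * X))
      (hs.filter_of_between (φ := φ) (p := fun w => X < w ∧ w ≤ 2 * X) hbet (by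
        intro u v w hu hv h1 h2
        rcases min_le_iff.1 h1 with h1 | h1 <;> rcases le_max_iff.1 h2 with h2 | h2 <;>
          constructor <;> linarith [hu.1, hv.1, hu.2, hv.2]))
      (fun n hn => hsq n (hmem n hn).1) (X := X / 2) (Y := 3 * X) (ell := X / D) (by linarith)
      (by linarith) (by linarith) (by positivity)
      (by
        intro n hn n' hn' h
        refine hlen X n (hmem n hn).1 n' (hmem n' hn').1 h ?_
        rw [abs_le]
        constructor <;> linarith [(hmem n hn).2.1, (hmem n hn).2.2, (hmem n' hn').2.1,
          (hmem n' hn').2.2])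
      (by
        intro n hn x hx
        have hn1 : ((n : ℝ) + 1) / q ≤ 1 := by
          rw [div_le_one hq']; exact_mod_cast hsq n (hmem n hn).1
        have hn0 : 0 ≤ (n : ℝ) / q := by positivity
        have hnn : (n : ℝ) / q ≤ ((n : ℝ) + 1) / q := by gcongr; linarith
        have hl := hlip ((n : ℝ) / q) ⟨hn0, by linarith⟩ x ⟨by linarith [hx.1], by linarith [hx.2]⟩
        have hx' : |x - (n : ℝ) / q| ≤ 1 / q := by
          rw [abs_of_nonneg (by linarith [hx.1])]
          have := hx.2
          rw [add_div] at this
          linarith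
        have : E * |x - (n : ℝ) / q| ≤ X / 2 := by
          refine le_trans ?_ hEX
          calc E * |x - (n : ℝ) / q| ≤ E * (1 / q) := by gcongr
            _ = E / q := by ring
        have h3 := abs_le.1 (hl.trans this)
        have h4 := (hmem n hn).2
        simp only [hφ] at h4
        constructor <;> linarith [h3.1, h3.2, h4.1, h4.2])
    refine hv.trans ?_
    have hsX : 0 < √X := Real.sqrt_pos.2 hX0
    have es : √(X / 2 / q) = √X / √(2 * q) := by
      rw [div_div, Real.sqrt_div hX0.le]
    rw [es]
    have hs2 : 0 < √(2 * (q : ℝ)) := Real.sqrt_pos.2 (by positivity)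
    have hXX : √X * √X = X := Real.mul_self_sqrt hX0.le
    have e1 : (3 * X * (X / D) + 2) * (5 / (√X / √(2 * q)))
        = 15 * (X * (X / √X)) / D * √(2 * q) + 10 * √(2 * q) / √X := by
      field_simp
      ring
    have e2 : X / √X = √X := by rw [div_eq_iff hsX.ne']; exact hXX.symm
    rw [e1, e2]
    have hXE : X ≤ E := by linarith
    have hE2 : 0 < √(E / 2 ^ k) := Real.sqrt_pos.2 (by positivity)
    gcongr
  have step : ∀ i : ℕ, i ≤ k → ‖∑ n ∈ s, unitExp (q * F ((n : ℝ) / q))‖ ≤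
      i * (15 * (E * √E) / D * √(2 * q) + 10 * √(2 * q) / √(E / 2 ^ k))
        + ‖∑ n ∈ s.filter (fun n => φ n ≤ E / 2 ^ i), unitExp (q * F ((n : ℝ) / q))‖ := by
    intro i
    induction i with
    | zero =>
      intro _
      rw [Finset.filter_true_of_mem]
      · simp
      · intro n hn; simpa using (h0 n hn).2
    | succ i ih =>
      intro hi
      have ih := ih (by omega)
      have hl := level (E / 2 ^ (i + 1)) (by gcongr; norm_num)
        (by
          rw [pow_succ, ← div_div]
          have : E / 2 ^ i ≤ E := div_le_self hE.le (one_le_pow₀ (by norm_num))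
          linarith)
      have e : (2 : ℝ) * (E / 2 ^ (i + 1)) = E / 2 ^ i := by rw [pow_succ]; field_simp
      rw [e] at hl
      have hsplit : ∑ n ∈ s.filter (fun n => φ n ≤ E / 2 ^ i), unitExp (q * F ((n : ℝ) / q))
          = ∑ n ∈ s.filter (fun n => φ n ≤ E / 2 ^ (i + 1)), unitExp (q * F ((n : ℝ) / q))
          + ∑ n ∈ s.filter (fun n => E / 2 ^ (i + 1) < φ n ∧ φ n ≤ E / 2 ^ i),
            unitExp (q * F ((n : ℝ) / q)) := by
        rw [← Finset.sum_filter_add_sum_filter_not (s.filter (fun n => φ n ≤ E / 2 ^ i))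
          (fun n => φ n ≤ E / 2 ^ (i + 1)), Finset.filter_filter, Finset.filter_filter]
        have hle : E / 2 ^ (i + 1) ≤ E / 2 ^ i := by
          rw [← e]
          linarith [show 0 < E / 2 ^ (i + 1) by positivity]
        congr 2
        · ext n
          simp only [Finset.mem_filter]
          exact ⟨fun h => ⟨h.1, h.2.2⟩, fun h => ⟨h.1, h.2.trans hle, h.2⟩⟩
        · ext n
          simp only [Finset.mem_filter, not_le]
          tauto
      rw [hsplit] at ih
      have := ih.trans (add_le_add_right (norm_add_le _ _) _)
      push_cast
      linarith
  refine (step k le_rfl).trans ?_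
  gcongr
  refine (norm_sum_unitExp_le_card _ _).trans ?_
  have hmem : ∀ n ∈ s.filter (fun n => φ n ≤ E / 2 ^ k), n ∈ s ∧ φ n ≤ E / 2 ^ k :=
    fun n hn => Finset.mem_filter.1 hn
  rcases (s.filter (fun n => φ n ≤ E / 2 ^ k)).eq_empty_or_nonempty with h | hne
  · rw [h]; simp; positivity
  set t := s.filter (fun n => φ n ≤ E / 2 ^ k) with ht
  have m1 := hmem _ (t.min'_mem hne)
  have m2 := hmem _ (t.max'_mem hne)
  have hle := t.min'_le _ (t.max'_mem hne)
  have hd := hlen (E / 2 ^ k) _ m1.1 _ m2.1 hle (by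
    have a1 := (h0 _ m1.1).1
    have a2 := (h0 _ m2.1).1
    have a3 := m1.2
    have a4 := m2.2
    simp only [hφ] at a3 a4 ⊢
    rw [abs_le]; constructor <;> linarith)
  have hc := card_le_of_separated (fun n => (n : ℝ)) t (lam := 1) (A := t.min' hne)
    (B := t.max' hne) one_pos (by exact_mod_cast hle) (by intros; simp)
    (fun n hn => by exact_mod_cast t.min'_le n hn) (fun n hn => by exact_mod_cast t.le_max' n hn)
  refine hc.trans ?_
  rw [div_one]
  have : E / 2 ^ k / D * q = q * (E / 2 ^ k) / D := by ring
  linarith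

lemma norm_sum_unitExp_neg (g : ℕ → ℝ) (s : Finset ℕ) :
    ‖∑ n ∈ s, unitExp (-g n)‖ = ‖∑ n ∈ s, unitExp (g n)‖ := by
  simp_rw [unitExp_neg]
  rw [← map_sum, RCLike.norm_conj]

lemma norm_sum_le_of_strict_second_deriv {F F' F'' : ℝ → ℝ}
    (hF : ∀ x ∈ Icc (0 : ℝ) 1, HasDerivWithinAt F (F' x) (Icc (0 : ℝ) 1) x)
    (hF' : ∀ x ∈ Icc (0 : ℝ) 1, HasDerivWithinAt F' (F'' x) (Icc (0 : ℝ) 1) x)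
    {q : ℕ} (hq : 0 < q) {D E : ℝ} (hD : 0 < D) (hE : 0 < E) (hEq : E ≤ q)
    (hlip : ∀ x ∈ Icc (0 : ℝ) 1, ∀ y ∈ Icc (0 : ℝ) 1, |F'' y - F'' x| ≤ E * |y - x|)
    (k : ℕ) (hk : 2 ^ (k + 1) ≤ q)
    (s : Finset ℕ) (hs : GapFree s) (hsq : ∀ n ∈ s, n < q)
    (hbet : ∀ x ∈ s, ∀ y ∈ s, ∀ z : ℕ, x ≤ z → z ≤ y →
      min (F'' ((x : ℝ) / q)) (F'' ((y : ℝ) / q)) ≤ F'' ((z : ℝ) / q) ∧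
      F'' ((z : ℝ) / q) ≤ max (F'' ((x : ℝ) / q)) (F'' ((y : ℝ) / q)))
    (hsep : ∀ x ∈ s, ∀ y ∈ s, x ≤ y →
      D * (((y : ℝ) - x) / q) ≤ |F'' ((y : ℝ) / q) - F'' ((x : ℝ) / q)|)
    (hb : ∀ x ∈ s, |F'' ((x : ℝ) / q)| ≤ E) :
    ‖∑ n ∈ s, unitExp (q * F ((n : ℝ) / q))‖ ≤
      2 * (k * (15 * (E * √E) / D * √(2 * q) + 10 * √(2 * q) / √(E / 2 ^ k))
        + (q * (E / 2 ^ k) / D + 1)) := by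
  rw [← Finset.sum_filter_add_sum_filter_not s (fun n => 0 ≤ F'' ((n : ℝ) / q)), two_mul]
  refine (norm_add_le _ _).trans (add_le_add ?_ ?_)
  · have hm : ∀ n ∈ s.filter (fun n : ℕ => 0 ≤ F'' ((n : ℝ) / q)),
        n ∈ s ∧ 0 ≤ F'' ((n : ℝ) / q) := fun n hn => Finset.mem_filter.1 hn
    exact norm_sum_le_of_monotone_second_deriv hF hF' hq hD hE hEq hlip k hk _
      (hs.filter_of_between (φ := fun n => F'' ((n : ℝ) / q)) (p := fun w => 0 ≤ w) hbet
        (fun u v w hu hv h1 _ => (le_min hu hv).trans h1))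
      (fun n hn => hsq n (hm n hn).1)
      (fun x hx y hy => hbet x (hm x hx).1 y (hm y hy).1)
      (fun x hx y hy => hsep x (hm x hx).1 y (hm y hy).1)
      (fun x hx => ⟨(hm x hx).2, (abs_le.1 (hb x (hm x hx).1)).2⟩)
  · have hm : ∀ n ∈ s.filter (fun n : ℕ => ¬ 0 ≤ F'' ((n : ℝ) / q)),
        n ∈ s ∧ ¬ 0 ≤ F'' ((n : ℝ) / q) := fun n hn => Finset.mem_filter.1 hn
    have h := norm_sum_le_of_monotone_second_deriv (F := -F) (F' := -F') (F'' := -F'')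
      (fun x hx => (hF x hx).neg)
      (fun x hx => (hF' x hx).neg) hq hD hE hEq
      (by
        intro x hx y hy
        have := hlip x hx y hy
        rw [← abs_neg] at this
        simp only [Pi.neg_apply]
        convert this using 2
        ring) k hk (s.filter (fun n : ℕ => ¬ 0 ≤ F'' ((n : ℝ) / q)))
      (hs.filter_of_between (φ := fun n => F'' ((n : ℝ) / q)) (p := fun w => ¬ 0 ≤ w) hbet
        (fun u v w hu hv _ h2 => not_le.2 (h2.trans_lt (max_lt (not_le.1 hu) (not_le.1 hv)))))
      (fun n hn => hsq n (hm n hn).1)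
      (by
        intro x hx y hy z hxz hzy
        have := hbet x (hm x hx).1 y (hm y hy).1 z hxz hzy
        simp only [Pi.neg_apply]
        rw [min_neg_neg, max_neg_neg]
        exact ⟨neg_le_neg this.2, neg_le_neg this.1⟩)
      (by
        intro x hx y hy hxy
        have := hsep x (hm x hx).1 y (hm y hy).1 hxy
        rw [← abs_neg] at this
        simp only [Pi.neg_apply]
        convert this using 2
        ring)
      (by
        intro x hx
        have h1 := (abs_le.1 (hb x (hm x hx).1)).1
        have h2 := (hm x hx).2
        simp only [Pi.neg_apply]
        constructor <;> linarith)
    simp only [Pi.neg_apply, mul_neg] at h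
    rwa [norm_sum_unitExp_neg] at h

lemma norm_sum_le_of_piece_pos {F F' F'' F''' : ℝ → ℝ}
    (hF : ∀ x ∈ Icc (0 : ℝ) 1, HasDerivWithinAt F (F' x) (Icc (0 : ℝ) 1) x)
    (hF' : ∀ x ∈ Icc (0 : ℝ) 1, HasDerivWithinAt F' (F'' x) (Icc (0 : ℝ) 1) x)
    (hF'' : ∀ x ∈ Icc (0 : ℝ) 1, HasDerivWithinAt F'' (F''' x) (Icc (0 : ℝ) 1) x)
    {q : ℕ} (hq : 0 < q) {D E : ℝ} (hD : 0 < D) (hDE : D ≤ E) (hEq : E ≤ q)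
    (hb2 : ∀ x ∈ Icc (0 : ℝ) 1, |F'' x| ≤ E) (hb3 : ∀ x ∈ Icc (0 : ℝ) 1, |F''' x| ≤ E)
    (k : ℕ) (hk : 2 ^ (k + 1) ≤ q)
    (s : Finset ℕ) (hs : GapFree s) (hsq : ∀ n ∈ s, n < q) {a b : ℝ} (hab : Icc a b ⊆ Icc 0 1)
    (hsa : ∀ n ∈ s, a ≤ (n : ℝ) / q) (hsb : ∀ n ∈ s, ((n : ℝ) + 1) / q ≤ b)
    (halt : (∀ x ∈ Icc a b, D ≤ F'' x) ∨ (∀ x ∈ Icc a b, D ≤ F''' x)) :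
    ‖∑ n ∈ s, unitExp (q * F ((n : ℝ) / q))‖ ≤
      2 * (k * (15 * (E * √E) / D * √(2 * q) + 10 * √(2 * q) / √(E / 2 ^ k))
        + (q * (E / 2 ^ k) / D + 1)) + (E + 2) * (5 / √(D / q)) := by
  have hq' : (0 : ℝ) < q := by exact_mod_cast hq
  have hE : 0 < E := hD.trans_le hDE
  have hmem : ∀ n ∈ s, (n : ℝ) / q ∈ Icc a b := fun n hn =>
    ⟨hsa n hn, le_trans (by gcongr; linarith) (hsb n hn)⟩
  rcases halt with h | h
  · have hv := van_der_corput_of_deriv hF hF' hq s hs hsq hD (hDE.trans hEq) hE.le zero_le_one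
      (by
        intro n hn n' hn' _
        have : (n' : ℝ) < q := by exact_mod_cast hsq n' hn'
        have : (0 : ℝ) ≤ n := Nat.cast_nonneg n
        linarith)
      (by
        intro n hn x hx
        have hx' : x ∈ Icc a b := ⟨(hsa n hn).trans hx.1, hx.2.trans (hsb n hn)⟩
        exact ⟨h x hx', (abs_le.1 (hb2 x (hab hx'))).2⟩)
    rw [mul_one] at hv
    refine hv.trans ?_
    have : 0 ≤ 2 * (k * (15 * (E * √E) / D * √(2 * q) + 10 * √(2 * q) / √(E / 2 ^ k))
        + (q * (E / 2 ^ k) / D + 1)) := by positivity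
    linarith
  · have hmono := mul_sub_le_sub_of_le_hasDerivWithinAt
      (fun x hx => (hF'' x (hab hx)).mono hab) h
    have hv := norm_sum_le_of_strict_second_deriv hF hF' hq hD hE hEq
      (abs_sub_le_of_hasDerivWithinAt hF'' hb3) k hk s hs hsq
      (by
        intro x hx y hy z hxz hzy
        have hz := hs x hx y hy z hxz hzy
        have hxz' : (x : ℝ) / q ≤ (z : ℝ) / q := by gcongr
        have hzy' : (z : ℝ) / q ≤ (y : ℝ) / q := by gcongr
        have h1 := hmono _ (hmem x hx) _ (hmem z hz) hxz'
        have h2 := hmono _ (hmem z hz) _ (hmem y hy) hzy'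
        have p1 := mul_nonneg hD.le (sub_nonneg.2 hxz')
        have p2 := mul_nonneg hD.le (sub_nonneg.2 hzy')
        exact ⟨(min_le_left _ _).trans (by linarith), le_trans (by linarith) (le_max_right _ _)⟩)
      (by
        intro x hx y hy hxy
        refine le_trans ?_ (le_abs_self _)
        have h1 := hmono _ (hmem x hx) _ (hmem y hy) (by gcongr)
        rwa [← sub_div] at h1)
      (fun x hx => hb2 _ (hab (hmem x hx)))
    refine hv.trans ?_
    have : 0 ≤ (E + 2) * (5 / √(D / q)) := by positivity
    linarith

lemma norm_sum_le_of_piece {F F' F'' F''' : ℝ → ℝ}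
    (hF : ∀ x ∈ Icc (0 : ℝ) 1, HasDerivWithinAt F (F' x) (Icc (0 : ℝ) 1) x)
    (hF' : ∀ x ∈ Icc (0 : ℝ) 1, HasDerivWithinAt F' (F'' x) (Icc (0 : ℝ) 1) x)
    (hF'' : ∀ x ∈ Icc (0 : ℝ) 1, HasDerivWithinAt F'' (F''' x) (Icc (0 : ℝ) 1) x)
    {q : ℕ} (hq : 0 < q) {D E : ℝ} (hD : 0 < D) (hDE : D ≤ E) (hEq : E ≤ q)
    (hb2 : ∀ x ∈ Icc (0 : ℝ) 1, |F'' x| ≤ E) (hb3 : ∀ x ∈ Icc (0 : ℝ) 1, |F''' x| ≤ E)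
    (k : ℕ) (hk : 2 ^ (k + 1) ≤ q)
    (s : Finset ℕ) (hs : GapFree s) (hsq : ∀ n ∈ s, n < q) {a b : ℝ} (hab : Icc a b ⊆ Icc 0 1)
    (hsa : ∀ n ∈ s, a ≤ (n : ℝ) / q) (hsb : ∀ n ∈ s, ((n : ℝ) + 1) / q ≤ b)
    (halt : ((∀ x ∈ Icc a b, D ≤ F'' x) ∨ (∀ x ∈ Icc a b, D ≤ F''' x)) ∨
      ((∀ x ∈ Icc a b, D ≤ -F'' x) ∨ (∀ x ∈ Icc a b, D ≤ -F''' x))) :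
    ‖∑ n ∈ s, unitExp (q * F ((n : ℝ) / q))‖ ≤
      2 * (k * (15 * (E * √E) / D * √(2 * q) + 10 * √(2 * q) / √(E / 2 ^ k))
        + (q * (E / 2 ^ k) / D + 1)) + (E + 2) * (5 / √(D / q)) := by
  rcases halt with h | h
  · exact norm_sum_le_of_piece_pos hF hF' hF'' hq hD hDE hEq hb2 hb3 k hk s hs hsq hab hsa hsb h
  · have := norm_sum_le_of_piece_pos (fun x hx => (hF x hx).neg) (fun x hx => (hF' x hx).neg)
      (fun x hx => (hF'' x hx).neg) hq hD hDE hEq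
      (fun x hx => by simpa using hb2 x hx) (fun x hx => by simpa using hb3 x hx)
      k hk s hs hsq hab hsa hsb h
    simp only [Pi.neg_apply, mul_neg] at this
    rwa [norm_sum_unitExp_neg] at this

lemma exists_second_or_third_deriv_large {g₁ h₁ g₂ h₂ : ℝ → ℝ}
    (hg₁ : ContinuousOn g₁ (Icc (0 : ℝ) 1)) (hh₁ : ContinuousOn h₁ (Icc (0 : ℝ) 1))
    (hg₂ : ContinuousOn g₂ (Icc (0 : ℝ) 1)) (hh₂ : ContinuousOn h₂ (Icc (0 : ℝ) 1))
    (htor : ∀ x ∈ Icc (0 : ℝ) 1, g₁ x * h₂ x - g₂ x * h₁ x ≠ 0) :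
    ∃ κ K : ℝ, ∃ L : ℕ, 0 < κ ∧ κ ≤ K ∧ 1 ≤ K ∧ 0 < L ∧ ∀ u v : ℝ,
      (∀ x ∈ Icc (0 : ℝ) 1, |u * g₁ x + v * g₂ x| ≤ K * (|u| + |v|)) ∧
      (∀ x ∈ Icc (0 : ℝ) 1, |u * h₁ x + v * h₂ x| ≤ K * (|u| + |v|)) ∧
      ∀ a b : ℝ, Icc a b ⊆ Icc 0 1 → b - a ≤ 2 / L →
        ((∀ x ∈ Icc a b, κ * (|u| + |v|) ≤ u * g₁ x + v * g₂ x) ∨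
          (∀ x ∈ Icc a b, κ * (|u| + |v|) ≤ u * h₁ x + v * h₂ x)) ∨
        ((∀ x ∈ Icc a b, κ * (|u| + |v|) ≤ -(u * g₁ x + v * g₂ x)) ∨
          (∀ x ∈ Icc a b, κ * (|u| + |v|) ≤ -(u * h₁ x + v * h₂ x))) := by
  have hc : IsCompact (Icc (0 : ℝ) 1) := isCompact_Icc
  obtain ⟨A, hA⟩ := hc.exists_bound_of_continuousOn hg₁
  obtain ⟨B, hB⟩ := hc.exists_bound_of_continuousOn hh₁
  obtain ⟨A', hA'⟩ := hc.exists_bound_of_continuousOn hg₂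
  obtain ⟨B', hB'⟩ := hc.exists_bound_of_continuousOn hh₂
  simp only [Real.norm_eq_abs] at hA hB hA' hB'
  set K₀ : ℝ := |A| + |B| + |A'| + |B'| + 1 with hK₀
  have hK₀1 : 1 ≤ K₀ := by
    have := abs_nonneg A; have := abs_nonneg B; have := abs_nonneg A'; have := abs_nonneg B'
    linarith
  have bA : ∀ x ∈ Icc (0 : ℝ) 1, |g₁ x| ≤ K₀ := fun x hx => by
    linarith [hA x hx, le_abs_self A, abs_nonneg B, abs_nonneg A', abs_nonneg B']
  have bB : ∀ x ∈ Icc (0 : ℝ) 1, |h₁ x| ≤ K₀ := fun x hx => by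
    linarith [hB x hx, le_abs_self B, abs_nonneg A, abs_nonneg A', abs_nonneg B']
  have bA' : ∀ x ∈ Icc (0 : ℝ) 1, |g₂ x| ≤ K₀ := fun x hx => by
    linarith [hA' x hx, le_abs_self A', abs_nonneg B, abs_nonneg A, abs_nonneg B']
  have bB' : ∀ x ∈ Icc (0 : ℝ) 1, |h₂ x| ≤ K₀ := fun x hx => by
    linarith [hB' x hx, le_abs_self B', abs_nonneg B, abs_nonneg A', abs_nonneg A]
  obtain ⟨x₀, hx₀, hmin⟩ := hc.exists_isMinOn (nonempty_Icc.2 zero_le_one)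
    (((hg₁.mul hh₂).sub (hg₂.mul hh₁)).abs)
  set D₀ : ℝ := |g₁ x₀ * h₂ x₀ - g₂ x₀ * h₁ x₀| with hD₀
  have hD₀pos : 0 < D₀ := abs_pos.2 (htor x₀ hx₀)
  have hdet : ∀ x ∈ Icc (0 : ℝ) 1, D₀ ≤ |g₁ x * h₂ x - g₂ x * h₁ x| := fun x hx => hmin hx
  set κ₀ : ℝ := D₀ / (4 * K₀) with hκ₀
  have hκ₀pos : 0 < κ₀ := by positivity
  have lin : ∀ (p r : ℝ → ℝ) (M : ℝ) (u v x : ℝ), |p x| ≤ M → |r x| ≤ M →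
      |u * p x + v * r x| ≤ M * (|u| + |v|) := by
    intro p r M u v x hp hr
    refine (abs_add_le _ _).trans ?_
    rw [abs_mul, abs_mul]
    nlinarith [mul_le_mul_of_nonneg_left hp (abs_nonneg u),
      mul_le_mul_of_nonneg_left hr (abs_nonneg v)]
  have large : ∀ u v : ℝ, ∀ x ∈ Icc (0 : ℝ) 1,
      κ₀ * (|u| + |v|) ≤ |u * g₁ x + v * g₂ x| ∨ κ₀ * (|u| + |v|) ≤ |u * h₁ x + v * h₂ x| := by
    intro u v x hx
    set P := u * g₁ x + v * g₂ x with hP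
    set Q := u * h₁ x + v * h₂ x with hQ
    have hd := hdet x hx
    have e1 : |u| * |g₁ x * h₂ x - g₂ x * h₁ x| ≤ K₀ * (|P| + |Q|) := by
      rw [← abs_mul, show u * (g₁ x * h₂ x - g₂ x * h₁ x) = P * h₂ x - Q * g₂ x by
        rw [hP, hQ]; ring]
      refine (abs_sub _ _).trans ?_
      rw [abs_mul, abs_mul]
      nlinarith [mul_le_mul_of_nonneg_left (bB' x hx) (abs_nonneg P),
        mul_le_mul_of_nonneg_left (bA' x hx) (abs_nonneg Q)]
    have e2 : |v| * |g₁ x * h₂ x - g₂ x * h₁ x| ≤ K₀ * (|P| + |Q|) := by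
      rw [← abs_mul, show v * (g₁ x * h₂ x - g₂ x * h₁ x) = Q * g₁ x - P * h₁ x by
        rw [hP, hQ]; ring]
      refine (abs_sub _ _).trans ?_
      rw [abs_mul, abs_mul]
      nlinarith [mul_le_mul_of_nonneg_left (bB x hx) (abs_nonneg P),
        mul_le_mul_of_nonneg_left (bA x hx) (abs_nonneg Q)]
    have e3 : (|u| + |v|) * D₀ ≤ 2 * K₀ * (|P| + |Q|) := by
      nlinarith [mul_le_mul_of_nonneg_left hd (abs_nonneg u),
        mul_le_mul_of_nonneg_left hd (abs_nonneg v)]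
    have e4 : 2 * (κ₀ * (|u| + |v|)) ≤ |P| + |Q| := by
      have : 2 * (κ₀ * (|u| + |v|)) = (|u| + |v|) * D₀ / (2 * K₀) := by
        rw [hκ₀]; field_simp; norm_num
      rw [this, div_le_iff₀ (by positivity)]
      linarith
    by_contra! h
    linarith [h.1, h.2]
  have unif : ∀ p : ℝ → ℝ, ContinuousOn p (Icc (0 : ℝ) 1) → ∃ η > 0, ∀ x ∈ Icc (0 : ℝ) 1,
      ∀ y ∈ Icc (0 : ℝ) 1, |x - y| < η → |p x - p y| ≤ κ₀ / 2 := by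
    intro p hp
    obtain ⟨η, hη, h⟩ := Metric.uniformContinuousOn_iff.1
      (hc.uniformContinuousOn_of_continuous hp) (κ₀ / 2) (by positivity)
    exact ⟨η, hη, fun x hx y hy hxy => (h x hx y hy hxy).le⟩
  obtain ⟨η₁, hη₁, u₁⟩ := unif g₁ hg₁
  obtain ⟨η₂, hη₂, u₂⟩ := unif h₁ hh₁
  obtain ⟨η₃, hη₃, u₃⟩ := unif g₂ hg₂
  obtain ⟨η₄, hη₄, u₄⟩ := unif h₂ hh₂
  set η := min (min η₁ η₂) (min η₃ η₄) with hη
  have hηpos : 0 < η := lt_min (lt_min hη₁ hη₂) (lt_min hη₃ hη₄)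
  obtain ⟨L, hL⟩ := exists_nat_gt (2 / η)
  have hL0 : (0 : ℝ) < L := lt_trans (by positivity) hL
  refine ⟨κ₀ / 2, K₀ + κ₀, L, by positivity, by linarith, by linarith, by exact_mod_cast hL0, ?_⟩
  intro u v
  have hN : 0 ≤ |u| + |v| := by positivity
  refine ⟨fun x hx => (lin g₁ g₂ K₀ u v x (bA x hx) (bA' x hx)).trans (by gcongr; linarith),
    fun x hx => (lin h₁ h₂ K₀ u v x (bB x hx) (bB' x hx)).trans (by gcongr; linarith), ?_⟩
  intro a b hab hlen
  rcases lt_or_ge b a with hba | hba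
  · left; left
    intro x hx
    exact absurd (hx.1.trans hx.2) (not_le.2 hba)
  have ha : a ∈ Icc (0 : ℝ) 1 := hab ⟨le_rfl, hba⟩
  have h2L : 2 / (L : ℝ) < η := by
    rw [div_lt_iff₀ hL0]
    rw [div_lt_iff₀ hηpos] at hL
    linarith
  have hclose : ∀ x ∈ Icc a b, |x - a| < η := fun x hx => by
    rw [abs_of_nonneg (by linarith [hx.1])]
    linarith [hx.2]
  have varg : ∀ x ∈ Icc a b, |(u * g₁ x + v * g₂ x) - (u * g₁ a + v * g₂ a)|
      ≤ κ₀ / 2 * (|u| + |v|) := by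
    intro x hx
    have := lin (fun y => g₁ y - g₁ a) (fun y => g₂ y - g₂ a) (κ₀ / 2) u v x
      (u₁ x (hab hx) a ha ((hclose x hx).trans_le ((min_le_left _ _).trans (min_le_left _ _))))
      (u₃ x (hab hx) a ha ((hclose x hx).trans_le ((min_le_right _ _).trans (min_le_left _ _))))
    convert this using 2
    ring
  have varh : ∀ x ∈ Icc a b, |(u * h₁ x + v * h₂ x) - (u * h₁ a + v * h₂ a)|
      ≤ κ₀ / 2 * (|u| + |v|) := by
    intro x hx
    have := lin (fun y => h₁ y - h₁ a) (fun y => h₂ y - h₂ a) (κ₀ / 2) u v x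
      (u₂ x (hab hx) a ha ((hclose x hx).trans_le ((min_le_left _ _).trans (min_le_right _ _))))
      (u₄ x (hab hx) a ha ((hclose x hx).trans_le ((min_le_right _ _).trans (min_le_right _ _))))
    convert this using 2
    ring
  rcases large u v a ha with h | h
  · rcases le_abs.1 h with h | h
    · exact Or.inl (Or.inl fun x hx => by linarith [(abs_le.1 (varg x hx)).1])
    · exact Or.inr (Or.inl fun x hx => by linarith [(abs_le.1 (varg x hx)).2])
  · rcases le_abs.1 h with h | h
    · exact Or.inl (Or.inr fun x hx => by linarith [(abs_le.1 (varh x hx)).1])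
    · exact Or.inr (Or.inr fun x hx => by linarith [(abs_le.1 (varh x hx)).2])

lemma piece_bound_simplify {κ K N q : ℝ} {k : ℕ} (hκ : 0 < κ) (hK : 1 ≤ K) (hN : 1 ≤ N)
    (hk : 1 ≤ k) (hq : 2 ^ k ≤ q) :
    2 * (k * (15 * (K * N * √(K * N)) / (κ * N) * √(2 * q) + 10 * √(2 * q) / √(K * N / 2 ^ k))
        + (q * (K * N / 2 ^ k) / (κ * N) + 1)) + (K * N + 2) * (5 / √(κ * N / q)) ≤
      (30 * K * √K / κ * √2 + 20 * √2 / √K + 2 * (K / κ + 1) + 5 * (K + 2) / √κ) *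
        (k * (√q * (√N + √(2 ^ k) / √N)) + q / 2 ^ k) := by
  have hN0 : 0 < N := by linarith
  have hK0 : 0 < K := by linarith
  have h2k : (0 : ℝ) < 2 ^ k := by positivity
  have hq0 : 0 < q := h2k.trans_le hq
  have sN : 0 < √N := Real.sqrt_pos.2 hN0
  have sK : 0 < √K := Real.sqrt_pos.2 hK0
  have sκ : 0 < √κ := Real.sqrt_pos.2 hκ
  have sq : 0 < √q := Real.sqrt_pos.2 hq0
  have s2 : 0 < √(2 : ℝ) := Real.sqrt_pos.2 (by norm_num)
  have s2k : 0 < √((2 : ℝ) ^ k) := Real.sqrt_pos.2 h2k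
  have hk' : (1 : ℝ) ≤ k := by exact_mod_cast hk
  have hNN : √N * √N = N := Real.mul_self_sqrt hN0.le
  have hone : 1 ≤ q / 2 ^ k := (one_le_div h2k).2 hq
  rw [Real.sqrt_div (by positivity) (q : ℝ), Real.sqrt_div (by positivity) ((2 : ℝ) ^ k),
    Real.sqrt_mul hK0.le, Real.sqrt_mul hκ.le, Real.sqrt_mul (by norm_num : (0 : ℝ) ≤ 2)]
  set x := (k : ℝ) * (√q * √N) with hx
  set y := (k : ℝ) * (√q * (√(2 ^ k) / √N)) with hy
  set z := q / 2 ^ k with hz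
  have hx0 : 0 ≤ x := by positivity
  have hy0 : 0 ≤ y := by positivity
  have e0 : (k : ℝ) * (√q * (√N + √(2 ^ k) / √N)) + z = x + y + z := by rw [hx, hy]; ring
  have e1 : (k : ℝ) * (15 * (K * N * (√K * √N)) / (κ * N) * (√2 * √q))
      = 15 * K * √K / κ * √2 * x := by rw [hx]; field_simp
  have e2 : (k : ℝ) * (10 * (√2 * √q) / (√K * √N / √(2 ^ k))) = 10 * √2 / √K * y := by
    rw [hy]; field_simp
  have e3 : q * (K * N / 2 ^ k) / (κ * N) = K / κ * z := by rw [hz]; field_simp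
  have e4 : (K * N + 2) * (5 / (√κ * √N / √q)) ≤ 5 * (K + 2) / √κ * x := by
    have : (K * N + 2) ≤ (K + 2) * (√N * √N) := by rw [hNN]; nlinarith
    calc (K * N + 2) * (5 / (√κ * √N / √q)) ≤ (K + 2) * (√N * √N) * (5 / (√κ * √N / √q)) := by
          gcongr
      _ = 5 * (K + 2) / √κ * (1 * (√q * √N)) := by field_simp
      _ ≤ 5 * (K + 2) / √κ * x := by rw [hx]; gcongr
  rw [e0, mul_add (k : ℝ), e1, e2, e3]
  set A := 15 * K * √K / κ * √2 with hA
  set B := 10 * √2 / √K with hB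
  set G := K / κ with hG
  set H := 5 * (K + 2) / √κ with hH
  have hA0 : 0 ≤ A := by positivity
  have hB0 : 0 ≤ B := by positivity
  have hG0 : 0 ≤ G := by positivity
  have hH0 : 0 ≤ H := by positivity
  have e5 : 30 * K * √K / κ * √2 + 20 * √2 / √K + 2 * (G + 1) + H
      = 2 * A + 2 * B + 2 * (G + 1) + H := by rw [hA, hB]; ring
  rw [e5]
  nlinarith [mul_nonneg hA0 hy0, mul_nonneg hA0 (zero_le_one.trans hone), mul_nonneg hB0 hx0,
    mul_nonneg hB0 (zero_le_one.trans hone), mul_nonneg hG0 hx0, mul_nonneg hG0 hy0,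
    mul_nonneg hH0 hy0, mul_nonneg hH0 (zero_le_one.trans hone)]

/-- Bound for the exponential sums attached to a curve with nonvanishing torsion. -/
lemma exists_exponential_sum_bound
    {f₁ f₁' f₁'' f₁''' f₂ f₂' f₂'' f₂''' : ℝ → ℝ}
    (hf₁ : ∀ x ∈ Icc (0:ℝ) 1, HasDerivWithinAt f₁ (f₁' x) (Icc (0:ℝ) 1) x)
    (hf₁' : ∀ x ∈ Icc (0:ℝ) 1, HasDerivWithinAt f₁' (f₁'' x) (Icc (0:ℝ) 1) x)
    (hf₁'' : ∀ x ∈ Icc (0:ℝ) 1, HasDerivWithinAt f₁'' (f₁''' x) (Icc (0:ℝ) 1) x)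
    (hf₁''' : ContinuousOn f₁''' (Icc (0:ℝ) 1))
    (hf₂ : ∀ x ∈ Icc (0:ℝ) 1, HasDerivWithinAt f₂ (f₂' x) (Icc (0:ℝ) 1) x)
    (hf₂' : ∀ x ∈ Icc (0:ℝ) 1, HasDerivWithinAt f₂' (f₂'' x) (Icc (0:ℝ) 1) x)
    (hf₂'' : ∀ x ∈ Icc (0:ℝ) 1, HasDerivWithinAt f₂'' (f₂''' x) (Icc (0:ℝ) 1) x)
    (hf₂''' : ContinuousOn f₂''' (Icc (0:ℝ) 1))
    (htor : ∀ x ∈ Icc (0:ℝ) 1, f₁'' x * f₂''' x - f₂'' x * f₁''' x ≠ 0) :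
    ∃ C K : ℝ, ∃ L : ℕ, 0 < C ∧ 0 < K ∧ ∀ q : ℕ, 0 < q → L ≤ q → ∀ k : ℕ, 1 ≤ k →
      2 ^ (k + 1) ≤ q → ∀ u v : ℝ, 1 ≤ |u| + |v| → K * (|u| + |v|) ≤ q →
      ‖∑ n ∈ Finset.range q, unitExp (u * (q * f₁ ((n : ℝ) / q)) + v * (q * f₂ ((n : ℝ) / q)))‖ ≤
        C * (k * (√q * (√(|u| + |v|) + √(2 ^ k) / √(|u| + |v|))) + q / 2 ^ k) := by
  obtain ⟨κ, K, L, hκ, hκK, hK, hL, H⟩ := exists_second_or_third_deriv_large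
    (fun x hx => (hf₁'' x hx).continuousWithinAt) hf₁'''
    (fun x hx => (hf₂'' x hx).continuousWithinAt) hf₂''' htor
  have hK0 : 0 < K := by linarith
  have hL' : (0 : ℝ) < L := by exact_mod_cast hL
  refine ⟨L * (30 * K * √K / κ * √2 + 20 * √2 / √K + 2 * (K / κ + 1) + 5 * (K + 2) / √κ), K, L,
    by positivity, hK0, ?_⟩
  intro q hq hLq k hk hkq u v hN hKN
  obtain ⟨hb2, hb3, halt⟩ := H u v
  have hq' : (0 : ℝ) < q := by exact_mod_cast hq
  have hmaps : ∀ n ∈ Finset.range q, n * L / q ∈ Finset.range L := by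
    intro n hn
    rw [Finset.mem_range] at hn ⊢
    rw [Nat.div_lt_iff_lt_mul hq, mul_comm L]
    exact Nat.mul_lt_mul_of_pos_right hn hL
  have hphase : ∀ n : ℕ, u * (q * f₁ ((n : ℝ) / q)) + v * (q * f₂ ((n : ℝ) / q))
      = q * (fun x => u * f₁ x + v * f₂ x) ((n : ℝ) / q) := fun n => by ring
  simp_rw [hphase]
  rw [← Finset.sum_fiberwise_of_maps_to hmaps]
  refine (norm_sum_le _ _).trans ?_
  have hpiece : ∀ l ∈ Finset.range L, ‖∑ n ∈ Finset.range q with n * L / q = l,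
      unitExp (q * (fun x => u * f₁ x + v * f₂ x) ((n : ℝ) / q))‖ ≤
      (30 * K * √K / κ * √2 + 20 * √2 / √K + 2 * (K / κ + 1) + 5 * (K + 2) / √κ) *
        (k * (√q * (√(|u| + |v|) + √(2 ^ k) / √(|u| + |v|))) + q / 2 ^ k) := by
    intro l hl
    have hmem : ∀ n ∈ (Finset.range q).filter (fun n => n * L / q = l),
        n < q ∧ n * L / q = l := fun n hn => by simpa using hn
    have hab : Icc ((l : ℝ) / L) (min 1 (((l : ℝ) + 2) / L)) ⊆ Icc 0 1 :=
      Icc_subset_Icc (by positivity) (min_le_left _ _)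
    refine (norm_sum_le_of_piece (F := fun x => u * f₁ x + v * f₂ x)
      (F' := fun x => u * f₁' x + v * f₂' x) (F'' := fun x => u * f₁'' x + v * f₂'' x)
      (F''' := fun x => u * f₁''' x + v * f₂''' x)
      (fun x hx => ((hf₁ x hx).const_mul u).add ((hf₂ x hx).const_mul v))
      (fun x hx => ((hf₁' x hx).const_mul u).add ((hf₂' x hx).const_mul v))
      (fun x hx => ((hf₁'' x hx).const_mul u).add ((hf₂'' x hx).const_mul v))
      hq (D := κ * (|u| + |v|)) (E := K * (|u| + |v|)) (by positivity) (by gcongr) hKN hb2 hb3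
      k hkq _ ?_ (fun n hn => (hmem n hn).1) hab ?_ ?_ (halt _ _ hab ?_)).trans ?_
    · intro x hx y hy z hxz hzy
      have h1 := (hmem x hx).2
      have h2 := (hmem y hy)
      rw [Finset.mem_filter, Finset.mem_range]
      have m1 : x * L / q ≤ z * L / q := Nat.div_le_div_right (Nat.mul_le_mul_right _ hxz)
      have m2 : z * L / q ≤ y * L / q := Nat.div_le_div_right (Nat.mul_le_mul_right _ hzy)
      omega
    · intro n hn
      have h := (hmem n hn).2
      rw [div_le_div_iff₀ hL' hq']
      have : l * q ≤ n * L := by rw [← h]; exact Nat.div_mul_le_self _ _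
      exact_mod_cast this
    · intro n hn
      have h := hmem n hn
      apply le_min
      · rw [div_le_one hq']; exact_mod_cast h.1
      · rw [div_le_div_iff₀ hq' hL']
        have h3 : n * L < (l + 1) * q := by
          rw [← Nat.div_lt_iff_lt_mul hq]; omega
        have h4 : (n + 1) * L ≤ (l + 2) * q := by nlinarith
        exact_mod_cast h4
    · have := min_le_right 1 (((l : ℝ) + 2) / L)
      rw [add_div] at this ⊢
      linarith
    · refine piece_bound_simplify hκ hK hN hk ?_
      have : 2 ^ k ≤ q := le_trans (Nat.pow_le_pow_right (by norm_num) (by omega)) hkq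
      exact_mod_cast this
  refine (Finset.sum_le_sum hpiece).trans ?_
  rw [Finset.sum_const, Finset.card_range, nsmul_eq_mul]
  exact (mul_assoc _ _ _).ge

/-- Trigonometric polynomial with real coefficients `α 0, …, α (M - 1)`. -/
noncomputable def trigPoly (M : ℕ) (α : ℕ → ℝ) (y : ℝ) : ℂ :=
  ∑ k ∈ Finset.range M, α k * unitExp (k * y)

lemma norm_trigPoly_sq (M : ℕ) (α : ℕ → ℝ) (y : ℝ) :
    ((‖trigPoly M α y‖ ^ 2 : ℝ) : ℂ) =
      ∑ p ∈ Finset.range M ×ˢ Finset.range M,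
        ((α p.1 * α p.2 : ℝ) : ℂ) * unitExp (((p.1 : ℝ) - p.2) * y) := by
  rw [Complex.ofReal_pow, ← Complex.mul_conj', trigPoly, map_sum, Finset.sum_mul_sum,
    Finset.sum_product]
  refine Finset.sum_congr rfl fun k _ => Finset.sum_congr rfl fun l _ => ?_
  rw [map_mul, Complex.conj_ofReal, ← unitExp_neg, sub_mul, sub_eq_add_neg, unitExp_add]
  push_cast
  ring

/-- Total size of the off-diagonal exponential sums with frequencies below `M`. -/
noncomputable def offDiagSum (M q : ℕ) (y z : ℕ → ℝ) : ℝ :=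
  ∑ p ∈ Finset.range M ×ˢ Finset.range M, ∑ r ∈ Finset.range M ×ˢ Finset.range M,
    if p.1 = p.2 ∧ r.1 = r.2 then 0 else
      ‖∑ n ∈ Finset.range q,
        unitExp (((p.1 : ℝ) - p.2) * y n + ((r.1 : ℝ) - r.2) * z n)‖

lemma sum_diag (M : ℕ) (α : ℕ → ℝ) :
    ∑ p ∈ Finset.range M ×ˢ Finset.range M, (if p.1 = p.2 then α p.1 * α p.2 else 0)
      = ∑ k ∈ Finset.range M, α k ^ 2 := by
  rw [Finset.sum_product]
  refine Finset.sum_congr rfl fun k hk => ?_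
  simp only [Finset.sum_ite_eq, hk, if_true]
  ring

lemma abs_sum_sub_diag_le (M q : ℕ) (y z α β : ℕ → ℝ) {A B : ℝ}
    (hα : ∀ k < M, |α k| ≤ A) (hβ : ∀ k < M, |β k| ≤ B) :
    |∑ n ∈ Finset.range q, ‖trigPoly M α (y n)‖ ^ 2 * ‖trigPoly M β (z n)‖ ^ 2
      - q * ((∑ k ∈ Finset.range M, α k ^ 2) * ∑ k ∈ Finset.range M, β k ^ 2)|
      ≤ A ^ 2 * B ^ 2 * offDiagSum M q y z := by
  set P := Finset.range M ×ˢ Finset.range M with hP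
  have e1 : ((∑ n ∈ Finset.range q, ‖trigPoly M α (y n)‖ ^ 2 * ‖trigPoly M β (z n)‖ ^ 2 : ℝ) : ℂ)
      = ∑ p ∈ P, ∑ r ∈ P, ((α p.1 * α p.2 * (β r.1 * β r.2) : ℝ) : ℂ) *
        ∑ n ∈ Finset.range q,
          unitExp (((p.1 : ℝ) - p.2) * y n + ((r.1 : ℝ) - r.2) * z n) := by
    rw [Complex.ofReal_sum]
    have : ∀ n ∈ Finset.range q,
        ((‖trigPoly M α (y n)‖ ^ 2 * ‖trigPoly M β (z n)‖ ^ 2 : ℝ) : ℂ) =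
        ∑ p ∈ P, ∑ r ∈ P, ((α p.1 * α p.2 * (β r.1 * β r.2) : ℝ) : ℂ) *
          unitExp (((p.1 : ℝ) - p.2) * y n + ((r.1 : ℝ) - r.2) * z n) := by
      intro n _
      rw [Complex.ofReal_mul, norm_trigPoly_sq, norm_trigPoly_sq, Finset.sum_mul_sum]
      refine Finset.sum_congr rfl fun p _ => Finset.sum_congr rfl fun r _ => ?_
      rw [unitExp_add]
      push_cast
      ring
    rw [Finset.sum_congr rfl this, Finset.sum_comm]
    refine Finset.sum_congr rfl fun p _ => ?_
    rw [Finset.sum_comm]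
    refine Finset.sum_congr rfl fun r _ => ?_
    rw [Finset.mul_sum]
  have e2 : ((q * ((∑ k ∈ Finset.range M, α k ^ 2) * ∑ k ∈ Finset.range M, β k ^ 2) : ℝ) : ℂ)
      = ∑ p ∈ P, ∑ r ∈ P, ((α p.1 * α p.2 * (β r.1 * β r.2) : ℝ) : ℂ) *
        (if p.1 = p.2 ∧ r.1 = r.2 then (q : ℂ) else 0) := by
    rw [← sum_diag, ← sum_diag, Finset.sum_mul_sum, Finset.mul_sum, Complex.ofReal_sum]
    refine Finset.sum_congr rfl fun p _ => ?_
    rw [Finset.mul_sum, Complex.ofReal_sum]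
    refine Finset.sum_congr rfl fun r _ => ?_
    by_cases h1 : p.1 = p.2 <;> by_cases h2 : r.1 = r.2 <;> simp [h1, h2]
    ring
  rw [← Real.norm_eq_abs, ← Complex.norm_real, Complex.ofReal_sub, e1, e2,
    ← Finset.sum_sub_distrib]
  simp_rw [← Finset.sum_sub_distrib, ← mul_sub]
  rw [offDiagSum, Finset.mul_sum]
  refine (norm_sum_le _ _).trans (Finset.sum_le_sum fun p hp => ?_)
  rw [Finset.mul_sum]
  refine (norm_sum_le _ _).trans (Finset.sum_le_sum fun r hr => ?_)
  simp only [hP, Finset.mem_product, Finset.mem_range] at hp hr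
  have hc : ‖((α p.1 * α p.2 * (β r.1 * β r.2) : ℝ) : ℂ)‖ ≤ A ^ 2 * B ^ 2 := by
    rw [Complex.norm_real, Real.norm_eq_abs, abs_mul, abs_mul, abs_mul, sq, sq]
    have hA : 0 ≤ A := (abs_nonneg _).trans (hα _ hp.1)
    have hB : 0 ≤ B := (abs_nonneg _).trans (hβ _ hr.1)
    exact mul_le_mul (mul_le_mul (hα _ hp.1) (hα _ hp.2) (abs_nonneg _) hA)
      (mul_le_mul (hβ _ hr.1) (hβ _ hr.2) (abs_nonneg _) hB) (by positivity) (by positivity)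
  rw [norm_mul]
  split_ifs with h
  · simp [h.1, h.2, unitExp_zero]
  · rw [sub_zero]
    gcongr

/-- Coefficients of the smooth weight. -/
noncomputable def weightCoeff (M : ℕ) (k : ℕ) : ℝ := k * ((M : ℝ) - k)

/-- Discrete derivative of `weightCoeff`. -/
noncomputable def weightDiff (M : ℕ) (k : ℕ) : ℝ := (M : ℝ) - 1 - 2 * k

lemma trigPoly_weightDiff (M : ℕ) (y : ℝ) :
    unitExp y * trigPoly M (weightDiff M) y
      = (1 - unitExp y) * trigPoly M (weightCoeff M) y := by
  have key : ∀ N : ℕ, unitExp y * trigPoly N (weightDiff M) y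
      = (1 - unitExp y) * trigPoly N (weightCoeff M) y
        + weightCoeff M N * unitExp (N * y) := by
    intro N
    induction N with
    | zero => simp [trigPoly, weightCoeff]
    | succ N ih =>
      have h1 : ∀ α : ℕ → ℝ, trigPoly (N + 1) α y = trigPoly N α y + α N * unitExp (N * y) :=
        fun α => Finset.sum_range_succ _ _
      have h2 : unitExp (((N + 1 : ℕ) : ℝ) * y) = unitExp (N * y) * unitExp y := by
        rw [← unitExp_add]; congr 1; push_cast; ring
      rw [h1, h1, h2]
      have h3 : ((weightDiff M N : ℝ) : ℂ) = weightCoeff M (N + 1) - weightCoeff M N := by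
        rw [← Complex.ofReal_sub]
        congr 1
        simp only [weightDiff, weightCoeff]
        push_cast
        ring
      rw [h3]
      linear_combination ih
  rw [key M]
  simp [weightCoeff]

lemma norm_trigPoly_weightDiff_sq (M : ℕ) (y : ℝ) :
    ‖trigPoly M (weightDiff M) y‖ ^ 2
      = 2 * (1 - Real.cos (2 * π * y)) * ‖trigPoly M (weightCoeff M) y‖ ^ 2 := by
  have h := congrArg (fun w : ℂ => ‖w‖ ^ 2) (trigPoly_weightDiff M y)
  simp only [norm_mul, norm_unitExp, one_mul, mul_pow] at h
  rw [h]
  congr 1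
  rw [unitExp_eq, Complex.sq_norm, Complex.normSq_apply]
  simp
  nlinarith [Real.sin_sq_add_cos_sq (2 * π * y)]

lemma weightCoeff_bound {M k : ℕ} (hk : k < M) : |weightCoeff M k| ≤ (M : ℝ) ^ 2 := by
  have h : (k : ℝ) ≤ M := by exact_mod_cast hk.le
  have h0 : (0 : ℝ) ≤ k := Nat.cast_nonneg k
  rw [weightCoeff, abs_of_nonneg (mul_nonneg h0 (by linarith))]
  nlinarith

lemma weightDiff_bound {M k : ℕ} (hk : k < M) : |weightDiff M k| ≤ (M : ℝ) := by
  have h : (k : ℝ) + 1 ≤ M := by exact_mod_cast hk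
  have h0 : (0 : ℝ) ≤ k := Nat.cast_nonneg k
  rw [weightDiff, abs_le]
  constructor <;> linarith

lemma sum_weightCoeff_sq (M : ℕ) :
    ∑ k ∈ Finset.range M, weightCoeff M k ^ 2 = ((M : ℝ) ^ 5 - M) / 30 := by
  have key : ∀ N : ℕ, ∑ k ∈ Finset.range N, weightCoeff M k ^ 2
      = (M : ℝ) ^ 2 * ((N - 1) * N * (2 * N - 1) / 6) - 2 * M * ((N - 1) * N / 2) ^ 2
        + (N - 1) * N * (2 * N - 1) * (3 * (N : ℝ) ^ 2 - 3 * N - 1) / 30 := by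
    intro N
    induction N with
    | zero => simp
    | succ N ih =>
      rw [Finset.sum_range_succ, ih, weightCoeff]
      push_cast
      ring
  rw [key]
  ring

lemma sum_weightDiff_sq (M : ℕ) :
    ∑ k ∈ Finset.range M, weightDiff M k ^ 2 = ((M : ℝ) ^ 3 - M) / 3 := by
  have key : ∀ N : ℕ, ∑ k ∈ Finset.range N, weightDiff M k ^ 2
      = N * ((M : ℝ) - 1) ^ 2 - 4 * (M - 1) * ((N - 1) * N / 2)
        + 4 * ((N - 1) * N * (2 * N - 1) / 6) := by
    intro N
    induction N with
    | zero => simp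
    | succ N ih =>
      rw [Finset.sum_range_succ, ih, weightDiff]
      push_cast
      ring
  rw [key]
  ring

lemma norm_trigPoly_weightCoeff_le (M : ℕ) (y : ℝ) :
    ‖trigPoly M (weightCoeff M) y‖ ≤ (M : ℝ) ^ 3 := by
  refine (norm_sum_le _ _).trans ?_
  have : ∀ k ∈ Finset.range M, ‖(weightCoeff M k : ℂ) * unitExp (k * y)‖ ≤ (M : ℝ) ^ 2 := by
    intro k hk
    rw [norm_mul, norm_unitExp, mul_one, Complex.norm_real, Real.norm_eq_abs]
    exact weightCoeff_bound (Finset.mem_range.1 hk)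
  refine (Finset.sum_le_sum this).trans ?_
  rw [Finset.sum_const, Finset.card_range, nsmul_eq_mul]
  exact le_of_eq (by ring)

lemma nint_lt_of_cos_lt {y δ : ℝ} (hδ : 0 < δ) (hδ' : δ < 1 / 2)
    (h : Real.cos (2 * π * δ) < Real.cos (2 * π * y)) : nint y < δ := by
  by_contra! hle
  have hp := Real.pi_pos
  have e : Real.cos (2 * π * y) = Real.cos (2 * π * nint y) := by
    have h1 : Real.cos (2 * π * nint y) = Real.cos (2 * π * (y - round y)) := by
      rw [nint, ← Real.cos_abs (2 * π * (y - round y)), abs_mul, abs_of_pos (by positivity : 0 < 2 * π)]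
    rw [h1, show 2 * π * (y - round y) = 2 * π * y - round y * (2 * π) by ring,
      Real.cos_sub_int_mul_two_pi]
  rw [e] at h
  have hle2 : nint y ≤ 1 / 2 := abs_sub_round y
  have := Real.cos_le_cos_of_nonneg_of_le_pi (x := 2 * π * δ) (y := 2 * π * nint y)
    (by positivity) (by nlinarith) (by nlinarith)
  linarith

lemma eight_mul_sq_le_one_sub_cos {δ : ℝ} (hδ : 0 < δ) (hδ' : δ < 1 / 2) :
    8 * δ ^ 2 ≤ 1 - Real.cos (2 * π * δ) := by
  have hp := Real.pi_pos
  have h1 : 2 / π * (π * δ) ≤ Real.sin (π * δ) :=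
    Real.mul_le_sin (by positivity) (by nlinarith)
  have h2 : 2 / π * (π * δ) = 2 * δ := by field_simp
  rw [h2] at h1
  have h3 : Real.cos (2 * π * δ) = 1 - 2 * Real.sin (π * δ) ^ 2 := by
    rw [mul_assoc, Real.cos_two_mul, Real.cos_sq']
    ring
  rw [h3]
  nlinarith

lemma sum_minorant_le (M q : ℕ) (y z : ℕ → ℝ) {δ : ℝ} (hδ : 0 < δ) (hδ' : δ < 1 / 2) :
    ∑ n ∈ Finset.range q,
        ((1 - Real.cos (2 * π * δ)) *
            (‖trigPoly M (weightCoeff M) (y n)‖ ^ 2 * ‖trigPoly M (weightCoeff M) (z n)‖ ^ 2)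
          - 1 / 2 *
            (‖trigPoly M (weightDiff M) (y n)‖ ^ 2 * ‖trigPoly M (weightCoeff M) (z n)‖ ^ 2)
          - 1 / 2 *
            (‖trigPoly M (weightCoeff M) (y n)‖ ^ 2 * ‖trigPoly M (weightDiff M) (z n)‖ ^ 2))
      ≤ (1 - Real.cos (2 * π * δ)) * (M : ℝ) ^ 12 *
        ((Finset.range q).filter fun n => nint (y n) < δ ∧ nint (z n) < δ).card := by
  have hη : 0 ≤ 1 - Real.cos (2 * π * δ) := by linarith [Real.cos_le_one (2 * π * δ)]
  rw [mul_comm _ ((Finset.card _ : ℕ) : ℝ), ← nsmul_eq_mul, ← Finset.sum_const,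
    Finset.sum_filter]
  refine Finset.sum_le_sum fun n _ => ?_
  rw [norm_trigPoly_weightDiff_sq, norm_trigPoly_weightDiff_sq]
  have hT : ∀ w : ℝ, ‖trigPoly M (weightCoeff M) w‖ ^ 2 ≤ (M : ℝ) ^ 6 := fun w => by
    have := pow_le_pow_left₀ (norm_nonneg _) (norm_trigPoly_weightCoeff_le M w) 2
    calc _ ≤ _ := this
      _ = _ := by ring
  have hT1 := hT (y n)
  have hT2 := hT (z n)
  have p1 : 0 ≤ ‖trigPoly M (weightCoeff M) (y n)‖ ^ 2 := by positivity
  have p2 : 0 ≤ ‖trigPoly M (weightCoeff M) (z n)‖ ^ 2 := by positivity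
  set S := ‖trigPoly M (weightCoeff M) (y n)‖ ^ 2
  set T := ‖trigPoly M (weightCoeff M) (z n)‖ ^ 2
  have hST : 0 ≤ S * T := mul_nonneg p1 p2
  have c1 := Real.cos_le_one (2 * π * y n)
  have c2 := Real.cos_le_one (2 * π * z n)
  have e : (1 - Real.cos (2 * π * δ)) * (S * T)
      - 1 / 2 * (2 * (1 - Real.cos (2 * π * y n)) * S * T)
      - 1 / 2 * (S * (2 * (1 - Real.cos (2 * π * z n)) * T))
      = S * T * ((1 - Real.cos (2 * π * δ)) - (1 - Real.cos (2 * π * y n))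
        - (1 - Real.cos (2 * π * z n))) := by ring
  rw [e]
  split_ifs with h
  · have : S * T ≤ (M : ℝ) ^ 12 := by
      calc S * T ≤ (M : ℝ) ^ 6 * (M : ℝ) ^ 6 := mul_le_mul hT1 hT2 p2 (by positivity)
        _ = _ := by ring
    calc _ ≤ S * T * (1 - Real.cos (2 * π * δ)) :=
          mul_le_mul_of_nonneg_left (by linarith) hST
      _ ≤ (M : ℝ) ^ 12 * (1 - Real.cos (2 * π * δ)) := by gcongr
      _ = _ := by ring
  · refine mul_nonpos_of_nonneg_of_nonpos hST ?_
    by_contra! hpos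
    exact h ⟨nint_lt_of_cos_lt hδ hδ' (by linarith), nint_lt_of_cos_lt hδ hδ' (by linarith)⟩

lemma le_of_moment_bounds {δ m Q A Δ η P1 P2 S1 S2 S3 : ℝ} (hQ : 0 ≤ Q)
    (hm8 : 8 ≤ m) (hη0 : 0 < η) (hηm : 128 ≤ η * m ^ 2) (hM' : (δ * m) ^ 2 ≤ 25) (hA : 0 ≤ A)
    (hP2d : P2 = (m ^ 5 - m) / 30) (hP1d : P1 = (m ^ 3 - m) / 3)
    (hoff : Δ ≤ Q * m ^ 2 / 28800)
    (h1 : Q * (P2 * P2) - m ^ 8 * Δ ≤ S1)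
    (h2 : S2 ≤ Q * (P1 * P2) + m ^ 6 * Δ) (h3 : S3 ≤ Q * (P2 * P1) + m ^ 6 * Δ)
    (hup : η * S1 - 1 / 2 * S2 - 1 / 2 * S3 ≤ η * m ^ 12 * A) :
    1 / 360000 * δ ^ 2 * Q ≤ A := by
  have hm0 : 0 < m := by linarith
  have hP2 : m ^ 5 / 60 ≤ P2 := by
    have h8 : 8 ^ 4 ≤ m ^ 4 := by gcongr
    have h9 := mul_le_mul_of_nonneg_right h8 hm0.le
    have e : m ^ 4 * m = m ^ 5 := by ring
    linarith
  have hP2pos : 0 < P2 := lt_of_lt_of_le (by positivity) hP2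
  have hP1 : P1 ≤ η * P2 / 2 := by
    have h1 : η * (m ^ 5 / 60) ≤ η * P2 := by gcongr
    have h2 : 128 * m ^ 3 ≤ η * m ^ 2 * m ^ 3 := by gcongr
    have h3 : 0 < m ^ 3 := by positivity
    have e : η * (m ^ 5 / 60) = η * m ^ 2 * m ^ 3 / 60 := by ring
    linarith
  have hmain : Q * (η * m ^ 10 / 7200) ≤ Q * (η * P2 * P2 - P1 * P2) := by
    gcongr
    have h1 : P1 * P2 ≤ η * P2 / 2 * P2 := by gcongr
    have h2 : (m ^ 5 / 60) * (m ^ 5 / 60) ≤ P2 * P2 := by gcongr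
    have h3 := mul_le_mul_of_nonneg_left h2 hη0.le
    have e1 : η * (m ^ 5 / 60 * (m ^ 5 / 60)) = η * m ^ 10 / 3600 := by ring
    have e2 : η * P2 / 2 * P2 = η * (P2 * P2) / 2 := by ring
    have e3 : η * P2 * P2 = η * (P2 * P2) := by ring
    linarith
  have hlow : Q * (η * m ^ 10 / 7200) - Δ * (η * m ^ 8 + m ^ 6) ≤ η * m ^ 12 * A := by
    have b1 := mul_le_mul_of_nonneg_left h1 hη0.le
    have e1 : η * (Q * (P2 * P2) - m ^ 8 * Δ) - 1 / 2 * (Q * (P1 * P2) + m ^ 6 * Δ)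
        - 1 / 2 * (Q * (P2 * P1) + m ^ 6 * Δ)
        = Q * (η * P2 * P2 - P1 * P2) - Δ * (η * m ^ 8 + m ^ 6) := by ring
    linarith
  have hlow2 : η * m ^ 8 * (Q * m ^ 2 / 14400) ≤ η * m ^ 8 * (m ^ 4 * A) := by
    have g1 : m ^ 6 ≤ η * m ^ 8 := by
      have : 1 * m ^ 6 ≤ η * m ^ 2 * m ^ 6 := by
        gcongr
        linarith
      calc m ^ 6 = 1 * m ^ 6 := by ring
        _ ≤ _ := this
        _ = _ := by ring
    have g2 : Δ * (η * m ^ 8 + m ^ 6) ≤ Q * m ^ 2 / 28800 * (η * m ^ 8 + m ^ 6) := by gcongr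
    have g3 : Q * m ^ 2 / 28800 * (η * m ^ 8 + m ^ 6)
        ≤ Q * m ^ 2 / 28800 * (η * m ^ 8 + η * m ^ 8) := by gcongr
    have e1 : Q * m ^ 2 / 28800 * (η * m ^ 8 + η * m ^ 8) = Q * (η * m ^ 10 / 14400) := by ring
    have e2 : η * m ^ 8 * (Q * m ^ 2 / 14400) = Q * (η * m ^ 10 / 14400) := by ring
    have e3 : η * m ^ 8 * (m ^ 4 * A) = η * m ^ 12 * A := by ring
    have e4 : Q * (η * m ^ 10 / 7200) = 2 * (Q * (η * m ^ 10 / 14400)) := by ring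
    linarith
  have hlow3 : Q * m ^ 2 / 14400 ≤ m ^ 4 * A := le_of_mul_le_mul_left hlow2 (by positivity)
  have hlow4 : Q / 14400 ≤ m ^ 2 * A := by
    refine le_of_mul_le_mul_left (a := m ^ 2) ?_ (by positivity)
    have e : m ^ 2 * (m ^ 2 * A) = m ^ 4 * A := by ring
    linarith
  have h5 : δ ^ 2 * (Q / 14400) ≤ δ ^ 2 * (m ^ 2 * A) := by gcongr
  have h6 : (δ * m) ^ 2 * A ≤ 25 * A := by gcongr
  have e : δ ^ 2 * (m ^ 2 * A) = (δ * m) ^ 2 * A := by ring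
  linarith

lemma card_ge_of_offDiagSum_le {M q : ℕ} {y z : ℕ → ℝ} {δ : ℝ} (hδ : 0 < δ) (hδ' : δ < 1 / 2)
    (hM : 4 ≤ δ * M) (hM' : δ * M ≤ 5)
    (hoff : offDiagSum M q y z ≤ q * (M : ℝ) ^ 2 / 28800) :
    1 / 360000 * δ ^ 2 * q ≤
      (((Finset.range q).filter fun n => nint (y n) < δ ∧ nint (z n) < δ).card : ℝ) := by
  have hup := sum_minorant_le M q y z hδ hδ'
  have hη8 := eight_mul_sq_le_one_sub_cos hδ hδ'
  rw [Finset.sum_sub_distrib, Finset.sum_sub_distrib, ← Finset.mul_sum, ← Finset.mul_sum,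
    ← Finset.mul_sum] at hup
  have a1 := (abs_le.1 (abs_sum_sub_diag_le M q y z (weightCoeff M) (weightCoeff M)
    (fun k => weightCoeff_bound) fun k => weightCoeff_bound)).1
  have a2 := (abs_le.1 (abs_sum_sub_diag_le M q y z (weightDiff M) (weightCoeff M)
    (fun k => weightDiff_bound) fun k => weightCoeff_bound)).2
  have a3 := (abs_le.1 (abs_sum_sub_diag_le M q y z (weightCoeff M) (weightDiff M)
    (fun k => weightCoeff_bound) fun k => weightDiff_bound)).2
  rw [sum_weightCoeff_sq] at a1
  rw [sum_weightCoeff_sq, sum_weightDiff_sq] at a2 a3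
  have hM8 : (8 : ℝ) ≤ M := by
    have h0 : (0 : ℝ) ≤ M := Nat.cast_nonneg M
    nlinarith
  have hηm : 128 ≤ (1 - Real.cos (2 * π * δ)) * (M : ℝ) ^ 2 := by
    have g1 := mul_le_mul_of_nonneg_right hη8 (sq_nonneg (M : ℝ))
    have g2 : 4 ^ 2 ≤ (δ * M) ^ 2 := by gcongr
    have e : 8 * δ ^ 2 * (M : ℝ) ^ 2 = 8 * (δ * M) ^ 2 := by ring
    linarith
  have hM25 : (δ * M) ^ 2 ≤ 25 := by
    have : (δ * M) ^ 2 ≤ 5 ^ 2 := by gcongr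
    linarith
  have e1 : ((M : ℝ) ^ 2) ^ 2 * ((M : ℝ) ^ 2) ^ 2 * offDiagSum M q y z
    = (M : ℝ) ^ 8 * offDiagSum M q y z := by ring
  have e2 : (M : ℝ) ^ 2 * ((M : ℝ) ^ 2) ^ 2 * offDiagSum M q y z
    = (M : ℝ) ^ 6 * offDiagSum M q y z := by ring
  have e3 : ((M : ℝ) ^ 2) ^ 2 * (M : ℝ) ^ 2 * offDiagSum M q y z
    = (M : ℝ) ^ 6 * offDiagSum M q y z := by ring
  exact le_of_moment_bounds (Nat.cast_nonneg q) hM8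
    (lt_of_lt_of_le (by positivity) hη8) hηm hM25 (Nat.cast_nonneg _) rfl rfl hoff
    (by linarith) (by linarith) (by linarith) hup

lemma sum_inv_sqrt_le (m : ℕ) :
    ∑ j ∈ Finset.range m, 1 / √((j : ℝ) + 1) ≤ 2 * √(m : ℝ) := by
  induction m with
  | zero => simp
  | succ m ih =>
    rw [Finset.sum_range_succ]
    have h0 : (0 : ℝ) ≤ m := Nat.cast_nonneg m
    have s1 : √(m : ℝ) ^ 2 = m := Real.sq_sqrt h0
    have s2 : √((m : ℝ) + 1) ^ 2 = m + 1 := Real.sq_sqrt (by positivity)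
    have p1 := Real.sqrt_nonneg (m : ℝ)
    have p2 : 0 < √((m : ℝ) + 1) := Real.sqrt_pos.2 (by positivity)
    have : 1 / √((m : ℝ) + 1) ≤ 2 * √((m : ℝ) + 1) - 2 * √(m : ℝ) := by
      rw [div_le_iff₀ p2]
      nlinarith [sq_nonneg (√((m : ℝ) + 1) - √(m : ℝ))]
    push_cast
    linarith

/-- `1 / √|k - l|`, with the convention `1 / 0 = 0` on the diagonal. -/
noncomputable def invSqrtDist (k l : ℕ) : ℝ := 1 / √|(k : ℝ) - l|

lemma sum_invSqrtDist_le (M k : ℕ) (hk : k < M) :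
    ∑ l ∈ Finset.range M, invSqrtDist k l ≤ 4 * √(M : ℝ) := by
  have hsplit : ∑ l ∈ Finset.range M, invSqrtDist k l
      = ∑ l ∈ Finset.range k, invSqrtDist k l
        + ∑ j ∈ Finset.range (M - k), invSqrtDist k (k + j) := by
    conv_lhs => rw [← Nat.add_sub_cancel' hk.le, Finset.sum_range_add]
  have h1 : ∑ l ∈ Finset.range k, invSqrtDist k l ≤ 2 * √(M : ℝ) := by
    rw [← Finset.sum_range_reflect]
    have : ∀ j ∈ Finset.range k, invSqrtDist k (k - 1 - j) = 1 / √((j : ℝ) + 1) := by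
      intro j hj
      have hj := Finset.mem_range.1 hj
      have : ((k - 1 - j : ℕ) : ℝ) = k - 1 - j := by
        rw [Nat.sub_sub, Nat.cast_sub (by omega)]
        push_cast
        ring
      rw [invSqrtDist, this]
      have h0 : (0 : ℝ) ≤ j := Nat.cast_nonneg j
      rw [show (k : ℝ) - (k - 1 - j) = j + 1 by ring, abs_of_nonneg (by positivity)]
    rw [Finset.sum_congr rfl this]
    refine (sum_inv_sqrt_le k).trans ?_
    gcongr
  have h2 : ∑ j ∈ Finset.range (M - k), invSqrtDist k (k + j) ≤ 2 * √(M : ℝ) := by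
    obtain ⟨m, hm⟩ : ∃ m, M - k = m + 1 := ⟨M - k - 1, by omega⟩
    rw [hm, Finset.sum_range_succ']
    have : ∀ j ∈ Finset.range m, invSqrtDist k (k + (j + 1)) = 1 / √((j : ℝ) + 1) := by
      intro j _
      have h0 : (0 : ℝ) ≤ j := Nat.cast_nonneg j
      rw [invSqrtDist]
      push_cast
      rw [show (k : ℝ) - (k + (j + 1)) = -(j + 1) by ring, abs_neg, abs_of_nonneg (by positivity)]
    rw [Finset.sum_congr rfl this]
    have : invSqrtDist k (k + 0) = 0 := by simp [invSqrtDist]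
    rw [this, add_zero]
    refine (sum_inv_sqrt_le m).trans ?_
    gcongr
    omega
  rw [hsplit]
  linarith

lemma inv_sqrt_abs_add_abs_le (k l r s : ℕ) (h : ¬(k = l ∧ r = s)) :
    1 / √(|(k : ℝ) - l| + |(r : ℝ) - s|) ≤ invSqrtDist k l + invSqrtDist r s := by
  have n1 : 0 ≤ invSqrtDist k l := by unfold invSqrtDist; positivity
  have n2 : 0 ≤ invSqrtDist r s := by unfold invSqrtDist; positivity
  by_cases hkl : k = l
  · have hrs : r ≠ s := fun e => h ⟨hkl, e⟩
    have : 0 < |(r : ℝ) - s| := abs_pos.2 (sub_ne_zero.2 (by exact_mod_cast hrs))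
    refine le_trans ?_ (le_add_of_nonneg_left n1)
    unfold invSqrtDist
    gcongr
    linarith [abs_nonneg ((k : ℝ) - l)]
  · have : 0 < |(k : ℝ) - l| := abs_pos.2 (sub_ne_zero.2 (by exact_mod_cast hkl))
    refine le_trans ?_ (le_add_of_nonneg_right n2)
    unfold invSqrtDist
    gcongr
    linarith [abs_nonneg ((r : ℝ) - s)]

lemma one_le_abs_add_abs (k l r s : ℕ) (h : ¬(k = l ∧ r = s)) :
    1 ≤ |(k : ℝ) - l| + |(r : ℝ) - s| := by
  have key : ∀ a b : ℕ, a ≠ b → (1 : ℝ) ≤ |(a : ℝ) - b| := by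
    intro a b hab
    have : (1 : ℤ) ≤ |(a : ℤ) - b| := Int.one_le_abs (sub_ne_zero.2 (by exact_mod_cast hab))
    exact_mod_cast this
  by_cases hkl : k = l
  · have hrs : r ≠ s := fun e => h ⟨hkl, e⟩
    linarith [key r s hrs, abs_nonneg ((k : ℝ) - l)]
  · linarith [key k l hkl, abs_nonneg ((r : ℝ) - s)]

lemma abs_natCast_sub_le {k l M : ℕ} (hk : k < M) (hl : l < M) : |(k : ℝ) - l| ≤ M := by
  have h1 : (k : ℝ) ≤ M := by exact_mod_cast hk.le
  have h2 : (l : ℝ) ≤ M := by exact_mod_cast hl.le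
  have h3 : (0 : ℝ) ≤ k := Nat.cast_nonneg k
  have h4 : (0 : ℝ) ≤ l := Nat.cast_nonneg l
  rw [abs_le]
  constructor <;> linarith

/-- Summation of a pointwise bound with square-root behaviour over all off-diagonal frequencies. -/
lemma offDiagSum_le {M q : ℕ} {y z : ℕ → ℝ} {a b c : ℝ} (ha : 0 ≤ a) (hb : 0 ≤ b) (hc : 0 ≤ c)
    (hbound : ∀ u v : ℝ, 1 ≤ |u| + |v| → |u| + |v| ≤ 2 * M →
      ‖∑ n ∈ Finset.range q, unitExp (u * y n + v * z n)‖
        ≤ a * √(|u| + |v|) + b * (1 / √(|u| + |v|)) + c) :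
    offDiagSum M q y z ≤
      (M : ℝ) ^ 4 * (a * √(2 * M) + c) + 8 * b * (M : ℝ) ^ 3 * √(M : ℝ) := by
  have hpt : ∀ p ∈ Finset.range M ×ˢ Finset.range M, ∀ r ∈ Finset.range M ×ˢ Finset.range M,
      (if p.1 = p.2 ∧ r.1 = r.2 then 0 else
        ‖∑ n ∈ Finset.range q,
          unitExp (((p.1 : ℝ) - p.2) * y n + ((r.1 : ℝ) - r.2) * z n)‖)
      ≤ (a * √(2 * M) + c) + b * (invSqrtDist p.1 p.2 + invSqrtDist r.1 r.2) := by
    intro p hp r hr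
    simp only [Finset.mem_product, Finset.mem_range] at hp hr
    split_ifs with h
    · have n1 : 0 ≤ invSqrtDist p.1 p.2 := by unfold invSqrtDist; positivity
      have n2 : 0 ≤ invSqrtDist r.1 r.2 := by unfold invSqrtDist; positivity
      positivity
    · have hN : |(p.1 : ℝ) - p.2| + |(r.1 : ℝ) - r.2| ≤ 2 * M := by
        linarith [abs_natCast_sub_le hp.1 hp.2, abs_natCast_sub_le hr.1 hr.2]
      refine (hbound _ _ (one_le_abs_add_abs _ _ _ _ h) hN).trans ?_
      have h1 := mul_le_mul_of_nonneg_left (Real.sqrt_le_sqrt hN) ha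
      have h2 := mul_le_mul_of_nonneg_left (inv_sqrt_abs_add_abs_le _ _ _ _ h) hb
      linarith
  have hS : ∑ p ∈ Finset.range M ×ˢ Finset.range M, invSqrtDist p.1 p.2
      ≤ M * (4 * √(M : ℝ)) := by
    rw [Finset.sum_product]
    refine (Finset.sum_le_sum fun k hk => sum_invSqrtDist_le M k (Finset.mem_range.1 hk)).trans ?_
    rw [Finset.sum_const, Finset.card_range, nsmul_eq_mul]
  rw [offDiagSum]
  refine (Finset.sum_le_sum fun p hp => Finset.sum_le_sum fun r hr => hpt p hp r hr).trans ?_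
  simp only [Finset.sum_add_distrib, Finset.sum_const, ← Finset.mul_sum, mul_add,
    Finset.card_product, Finset.card_range, nsmul_eq_mul]
  push_cast
  have h1 := mul_le_mul_of_nonneg_left hS
    (by positivity : (0 : ℝ) ≤ 2 * ((M : ℝ) * M) * b)
  nlinarith

lemma pow_five_mul_log_sq_le {C δ : ℝ} {q : ℕ} (hC : 0 < C) (hq : 3 ≤ q)
    (h : C * (q : ℝ) ^ (-(1 : ℝ) / 5) * (Real.log q) ^ ((2 : ℝ) / 5) ≤ δ) :
    C ^ 5 * Real.log q ^ 2 ≤ δ ^ 5 * q := by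
  have hq3 : (3 : ℝ) ≤ q := by exact_mod_cast hq
  have hq0 : (0 : ℝ) < q := by linarith
  have hl : 0 ≤ Real.log q := Real.log_nonneg (by linarith)
  have h5 := pow_le_pow_left₀ (by positivity) h 5
  have e1 : ((q : ℝ) ^ (-(1 : ℝ) / 5)) ^ 5 = (q : ℝ)⁻¹ := by
    rw [← Real.rpow_natCast, ← Real.rpow_mul hq0.le, ← Real.rpow_neg_one]
    norm_num
  have e2 : ((Real.log q) ^ ((2 : ℝ) / 5)) ^ 5 = Real.log q ^ 2 := by
    rw [← Real.rpow_natCast, ← Real.rpow_mul hl, ← Real.rpow_natCast]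
    norm_num
  rw [mul_pow, mul_pow, e1, e2] at h5
  calc C ^ 5 * Real.log q ^ 2 = C ^ 5 * (q : ℝ)⁻¹ * Real.log q ^ 2 * q := by field_simp
    _ ≤ δ ^ 5 * q := by gcongr

lemma one_le_log_natCast {q : ℕ} (hq : 3 ≤ q) : 1 ≤ Real.log q := by
  have hq3 : (3 : ℝ) ≤ q := by exact_mod_cast hq
  rw [Real.le_log_iff_exp_le (by linarith)]
  linarith [Real.exp_one_lt_d9]

lemma exists_pow_two_parameter {W M q : ℕ} (hM : 2 ≤ W * M ^ 2)
    (hWM : 4 * (W * M ^ 2) ≤ q) :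
    ∃ k : ℕ, 1 ≤ k ∧ 2 ^ (k + 1) ≤ q ∧ W * M ^ 2 ≤ 2 ^ k ∧ 2 ^ k ≤ 2 * (W * M ^ 2) ∧
      (k : ℝ) ≤ 2 * Real.log q := by
  have hlt := Nat.pow_pred_clog_lt_self (b := 2) (by norm_num) (x := W * M ^ 2) (by omega)
  have hle := Nat.le_pow_clog (b := 2) (by norm_num) (W * M ^ 2)
  have hk1 : 1 ≤ Nat.clog 2 (W * M ^ 2) := Nat.clog_pos (by norm_num) (by omega)
  obtain ⟨j, hj⟩ : ∃ j, Nat.clog 2 (W * M ^ 2) = j + 1 := ⟨_, (Nat.sub_add_cancel hk1).symm⟩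
  rw [hj] at hlt hle
  simp only [Nat.pred_eq_sub_one, Nat.add_sub_cancel] at hlt
  have h1 : 2 ^ (j + 1) ≤ 2 * (W * M ^ 2) := by rw [pow_succ]; omega
  have h2 : 2 ^ (j + 1 + 1) ≤ q := by rw [pow_succ]; omega
  refine ⟨j + 1, by omega, h2, hle, h1, ?_⟩
  have h3 : ((2 : ℝ) ^ (j + 1)) ≤ q := by
    have : 2 ^ (j + 1) ≤ q := by omega
    exact_mod_cast this
  have h4 := Real.log_le_log (by positivity) h3
  rw [Real.log_pow] at h4
  have h5 := Real.log_two_gt_d9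
  have h6 : (0 : ℝ) ≤ ((j + 1 : ℕ) : ℝ) := Nat.cast_nonneg _
  nlinarith

lemma exists_parameters {C K : ℝ} (hC : 0 < C) :
    ∃ C₀ : ℝ, 0 < C₀ ∧ ∀ q : ℕ, 3 ≤ q → ∀ δ : ℝ, 0 < δ → δ < 1 / 2 →
      C₀ * (q : ℝ) ^ (-(1 : ℝ) / 5) * (Real.log q) ^ ((2 : ℝ) / 5) ≤ δ →
      ∃ M k : ℕ, 4 ≤ δ * M ∧ δ * M ≤ 5 ∧ 1 ≤ k ∧ 2 ^ (k + 1) ≤ q ∧ K * (2 * M) ≤ q ∧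
        (M : ℝ) ^ 4 * (C * k * √q * √(2 * M) + C * (q / 2 ^ k))
          + 8 * (C * k * √q * √(2 ^ k)) * (M : ℝ) ^ 3 * √(M : ℝ)
          ≤ q * (M : ℝ) ^ 2 / 28800 := by
  obtain ⟨W, hW⟩ := exists_nat_ge (max (57600 * C) (max K 1))
  have hWC : 57600 * C ≤ W := (le_max_left _ _).trans hW
  have hWK : K ≤ W := (le_max_left _ _).trans ((le_max_right _ _).trans hW)
  have hW1 : (1 : ℝ) ≤ W := (le_max_right _ _).trans ((le_max_right _ _).trans hW)
  refine ⟨5 * (36 * (W : ℝ) ^ 2) ^ 2, by positivity, ?_⟩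
  intro q hq δ hδ hδ' h
  have h5 := pow_five_mul_log_sq_le (by positivity) hq h
  have hl := one_le_log_natCast hq
  have hq3 : (3 : ℝ) ≤ q := by exact_mod_cast hq
  have hq0 : (0 : ℝ) < q := by linarith
  set l := Real.log q with hldef
  set D : ℝ := 36 * (W : ℝ) ^ 2 with hD
  have hD1 : 36 ≤ D := by nlinarith
  set M := ⌈4 / δ⌉₊ with hMdef
  have hM4 : 4 ≤ δ * M := by
    have := Nat.le_ceil (4 / δ)
    rw [div_le_iff₀ hδ] at this
    linarith
  have hM5 : δ * M ≤ 5 := by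
    have := Nat.ceil_lt_add_one (by positivity : 0 ≤ 4 / δ)
    have h2 := mul_le_mul_of_nonneg_left this.le hδ.le
    rw [mul_add, mul_div_cancel₀ _ hδ.ne'] at h2
    linarith
  clear_value M
  have hM8 : (8 : ℝ) ≤ M := by
    have h0 : (0 : ℝ) ≤ M := Nat.cast_nonneg M
    nlinarith
  have hM8n : 8 ≤ M := by exact_mod_cast hM8
  have hW1n : 1 ≤ W := by exact_mod_cast hW1
  have hM0 : (0 : ℝ) < M := by linarith
  have hkey : D ^ 2 * l ^ 2 * (M : ℝ) ^ 5 ≤ q := by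
    have g1 : (5 * D ^ 2) ^ 5 * l ^ 2 * (M : ℝ) ^ 5 ≤ δ ^ 5 * q * (M : ℝ) ^ 5 := by gcongr
    have g2 : (δ * M) ^ 5 * q ≤ 5 ^ 5 * q := by gcongr
    have g3 : D ^ 2 ≤ D ^ 10 := pow_le_pow_right₀ (by linarith) (by norm_num)
    have g4 : D ^ 2 * l ^ 2 * (M : ℝ) ^ 5 ≤ D ^ 10 * l ^ 2 * (M : ℝ) ^ 5 := by gcongr
    have e1 : (5 * D ^ 2) ^ 5 * l ^ 2 * (M : ℝ) ^ 5
      = 5 ^ 5 * (D ^ 10 * l ^ 2 * (M : ℝ) ^ 5) := by ring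
    have e2 : δ ^ 5 * q * (M : ℝ) ^ 5 = (δ * M) ^ 5 * q := by ring
    linarith
  have hM5q : 4 * ((W : ℝ) * (M : ℝ) ^ 2) ≤ q := by
    refine le_trans ?_ hkey
    have g1 : 4 * (W : ℝ) ≤ D ^ 2 := by nlinarith
    have g2 : 1 ≤ l ^ 2 := one_le_pow₀ hl
    have g3 : (M : ℝ) ^ 2 ≤ (M : ℝ) ^ 5 := pow_le_pow_right₀ (by linarith) (by norm_num)
    calc 4 * ((W : ℝ) * (M : ℝ) ^ 2) = 4 * (W : ℝ) * 1 * (M : ℝ) ^ 2 := by ring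
      _ ≤ D ^ 2 * l ^ 2 * (M : ℝ) ^ 5 := by gcongr
  obtain ⟨k, hk1, hkq, hk2, hk3, hkl⟩ := exists_pow_two_parameter (W := W) (M := M)
    (by nlinarith) (by exact_mod_cast hM5q : 4 * (W * M ^ 2) ≤ q)
  have hk2' : (W : ℝ) * (M : ℝ) ^ 2 ≤ 2 ^ k := by exact_mod_cast hk2
  have hk3' : (2 : ℝ) ^ k ≤ 2 * ((W : ℝ) * (M : ℝ) ^ 2) := by exact_mod_cast hk3
  refine ⟨M, k, hM4, hM5, hk1, hkq, ?_, ?_⟩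
  · have g1 : K * (2 * M) ≤ W * (2 * M) := by gcongr
    nlinarith [mul_pos (by linarith : (0 : ℝ) < W) hM0]
  have hthird : (M : ℝ) ^ 4 * (C * (q / 2 ^ k)) ≤ q * (M : ℝ) ^ 2 / 57600 := by
    have g1 : (M : ℝ) ^ 4 * (C * (q / 2 ^ k)) ≤ (M : ℝ) ^ 4 * (C * (q / (W * (M : ℝ) ^ 2))) := by
      gcongr
    have g2 : (M : ℝ) ^ 4 * (C * (q / (W * (M : ℝ) ^ 2))) = q * (M : ℝ) ^ 2 * (C / W) := by
      field_simp
    have g3 : C / W ≤ 1 / 57600 := by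
      rw [div_le_div_iff₀ (by linarith) (by norm_num)]
      linarith
    have g4 : q * (M : ℝ) ^ 2 * (C / W) ≤ q * (M : ℝ) ^ 2 * (1 / 57600) := by gcongr
    linarith
  have hsqrt : D * l * ((M : ℝ) ^ 2 * √(M : ℝ)) ≤ √q := by
    apply Real.le_sqrt_of_sq_le
    have e : (D * l * ((M : ℝ) ^ 2 * √(M : ℝ))) ^ 2 = D ^ 2 * l ^ 2 * (M : ℝ) ^ 5 := by
      rw [mul_pow, mul_pow, mul_pow (_ ^ 2), Real.sq_sqrt hM0.le]
      ring
    rw [e]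
    exact hkey
  have hs1 : √(2 * (M : ℝ)) ≤ 2 * W * √(M : ℝ) := by
    rw [Real.sqrt_mul (by norm_num)]
    gcongr
    rw [Real.sqrt_le_left (by positivity)]
    nlinarith
  have hs2 : √((2 : ℝ) ^ k) ≤ 2 * W * M := by
    rw [Real.sqrt_le_left (by positivity)]
    refine hk3'.trans ?_
    have : 2 * (W : ℝ) ≤ 4 * W ^ 2 := by nlinarith
    calc 2 * ((W : ℝ) * (M : ℝ) ^ 2) = 2 * (W : ℝ) * (M : ℝ) ^ 2 := by ring
      _ ≤ 4 * W ^ 2 * (M : ℝ) ^ 2 := by gcongr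
      _ = _ := by ring
  have hfirst : (M : ℝ) ^ 4 * (C * k * √q * √(2 * M))
      + 8 * (C * k * √q * √(2 ^ k)) * (M : ℝ) ^ 3 * √(M : ℝ) ≤ q * (M : ℝ) ^ 2 / 57600 := by
    have g1 : (M : ℝ) ^ 4 * (C * k * √q * √(2 * M))
        ≤ (M : ℝ) ^ 4 * (C * (2 * l) * √q * (2 * W * √(M : ℝ))) := by gcongr
    have g2 : 8 * (C * k * √q * √(2 ^ k)) * (M : ℝ) ^ 3 * √(M : ℝ)
        ≤ 8 * (C * (2 * l) * √q * (2 * W * M)) * (M : ℝ) ^ 3 * √(M : ℝ) := by gcongr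
    have g3 : 57600 * C * (36 * W * l * ((M : ℝ) ^ 2 * √(M : ℝ)) * (√q * (M : ℝ) ^ 2))
        ≤ W * (36 * W * l * ((M : ℝ) ^ 2 * √(M : ℝ)) * (√q * (M : ℝ) ^ 2)) := by gcongr
    have g4 : D * l * ((M : ℝ) ^ 2 * √(M : ℝ)) * (√q * (M : ℝ) ^ 2)
        ≤ √q * (√q * (M : ℝ) ^ 2) := by gcongr
    have e1 : √(q : ℝ) * (√q * (M : ℝ) ^ 2) = q * (M : ℝ) ^ 2 := by
      rw [← mul_assoc, Real.mul_self_sqrt hq0.le]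
    have e2 : W * (36 * W * l * ((M : ℝ) ^ 2 * √(M : ℝ)) * (√q * (M : ℝ) ^ 2))
        = D * l * ((M : ℝ) ^ 2 * √(M : ℝ)) * (√q * (M : ℝ) ^ 2) := by rw [hD]; ring
    have e3 : (M : ℝ) ^ 4 * (C * (2 * l) * √q * (2 * W * √(M : ℝ)))
        + 8 * (C * (2 * l) * √q * (2 * W * M)) * (M : ℝ) ^ 3 * √(M : ℝ)
        = C * (36 * W * l * ((M : ℝ) ^ 2 * √(M : ℝ)) * (√q * (M : ℝ) ^ 2)) := by ring
    linarith
  rw [mul_add]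
  linarith

lemma card_filter_le_ncard (q : ℕ) (f₁ f₂ : ℝ → ℝ) (δ : ℝ) :
    (((Finset.range q).filter fun n : ℕ =>
      nint ((q : ℝ) * f₁ ((n : ℝ) / q)) < δ ∧ nint ((q : ℝ) * f₂ ((n : ℝ) / q)) < δ).card : ℝ) ≤
      ({a : ℤ | 0 ≤ a ∧ (a : ℝ) ≤ q ∧
        nint ((q : ℝ) * f₁ ((a : ℝ) / q)) < δ ∧
        nint ((q : ℝ) * f₂ ((a : ℝ) / q)) < δ}.ncard : ℝ) := by
  have hfin : {a : ℤ | 0 ≤ a ∧ (a : ℝ) ≤ q ∧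
        nint ((q : ℝ) * f₁ ((a : ℝ) / q)) < δ ∧
        nint ((q : ℝ) * f₂ ((a : ℝ) / q)) < δ}.Finite := by
    refine (Set.finite_Icc (0 : ℤ) q).subset fun a ha => ⟨ha.1, ?_⟩
    exact_mod_cast ha.2.1
  refine Nat.cast_le.2 ?_
  rw [← Set.ncard_coe_finset]
  refine Set.ncard_le_ncard_of_injOn (fun n : ℕ => (n : ℤ)) ?_ (Nat.cast_injective.injOn) hfin
  intro n hn
  simp only [Finset.coe_filter, Finset.mem_range, Set.mem_ofPred_eq] at hn
  refine ⟨Int.natCast_nonneg n, ?_, ?_⟩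
  · have : (n : ℝ) ≤ q := by exact_mod_cast hn.1.le
    exact_mod_cast this
  · simpa using hn.2

theorem integral_points_close_to_space_curve_lower_bound
    (f₁ f₁' f₁'' f₁''' f₂ f₂' f₂'' f₂''' : ℝ → ℝ)
    (hf₁ : ∀ x ∈ Icc (0:ℝ) 1, HasDerivWithinAt f₁ (f₁' x) (Icc (0:ℝ) 1) x)
    (hf₁' : ∀ x ∈ Icc (0:ℝ) 1, HasDerivWithinAt f₁' (f₁'' x) (Icc (0:ℝ) 1) x)
    (hf₁'' : ∀ x ∈ Icc (0:ℝ) 1, HasDerivWithinAt f₁'' (f₁''' x) (Icc (0:ℝ) 1) x)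
    (hf₁''' : ContinuousOn f₁''' (Icc (0:ℝ) 1))
    (hf₂ : ∀ x ∈ Icc (0:ℝ) 1, HasDerivWithinAt f₂ (f₂' x) (Icc (0:ℝ) 1) x)
    (hf₂' : ∀ x ∈ Icc (0:ℝ) 1, HasDerivWithinAt f₂' (f₂'' x) (Icc (0:ℝ) 1) x)
    (hf₂'' : ∀ x ∈ Icc (0:ℝ) 1, HasDerivWithinAt f₂'' (f₂''' x) (Icc (0:ℝ) 1) x)
    (hf₂''' : ContinuousOn f₂''' (Icc (0:ℝ) 1))
    (htor : ∀ x ∈ Icc (0:ℝ) 1, f₁'' x * f₂''' x - f₂'' x * f₁''' x ≠ 0) :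
    ∃ c C : ℝ, ∃ Q₀ : ℕ, 0 < c ∧ 0 < C ∧ 0 < Q₀ ∧
      ∀ q : ℕ, Q₀ ≤ q → ∀ δ : ℝ, 0 < δ → δ < 1/2 →
        C * (q : ℝ) ^ (-(1 : ℝ)/5) * (Real.log q) ^ ((2 : ℝ)/5) ≤ δ →
        c * δ ^ 2 * q ≤
          ({a : ℤ | 0 ≤ a ∧ (a : ℝ) ≤ q ∧
            nint ((q : ℝ) * f₁ ((a : ℝ) / q)) < δ ∧
            nint ((q : ℝ) * f₂ ((a : ℝ) / q)) < δ}.ncard : ℝ) := by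
  obtain ⟨C, K, L, hC, hK, hbound⟩ :=
    exists_exponential_sum_bound hf₁ hf₁' hf₁'' hf₁''' hf₂ hf₂' hf₂'' hf₂''' htor
  obtain ⟨C₀, hC₀, hpar⟩ := exists_parameters (K := K) hC
  refine ⟨1 / 360000, C₀, max L 3, by norm_num, hC₀, by positivity, ?_⟩
  intro q hq δ hδ hδ' h
  have hq3 : 3 ≤ q := (le_max_right _ _).trans hq
  obtain ⟨M, k, hM4, hM5, hk1, hkq, hKM, hsum⟩ := hpar q hq3 δ hδ hδ' h
  refine le_trans ?_ (card_filter_le_ncard q f₁ f₂ δ)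
  refine card_ge_of_offDiagSum_le (y := fun n => (q : ℝ) * f₁ ((n : ℝ) / q))
    (z := fun n => (q : ℝ) * f₂ ((n : ℝ) / q)) hδ hδ' hM4 hM5 (le_trans ?_ hsum)
  refine offDiagSum_le (by positivity) (by positivity) (by positivity) fun u v h1 h2 => ?_
  have hKuv : K * (|u| + |v|) ≤ q := le_trans (by gcongr) hKM
  refine (hbound q (by omega) ((le_max_left _ _).trans hq) k hk1 hkq u v h1 hKuv).trans
    (le_of_eq ?_)
  ring
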